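/- Let q be a power of a prime and F_q the finite field with q elements. Let A ⊆ F_q \ {0} with |A| ≥ 2 and suppose 0 ∉ A + 1/A. Suppose there is a constant C > 0 such that for every proper subfield G of F_q and all elements c, d ∈ F_q one has |(A + 1/A)^{-1} ∩ (cG + d)| ≤ C·max{|G|^{1/2}, |A + 1/A|^{51/52}}. Then there is a constant c' > 0 depending only on C such that |A + 1/A| ≥ c'·min{|A|^{1 + 1/831}, q^{1/761}|A|^{1 - 1/761}}. -/

import Mathlib

open scoped Classical Pointwise

noncomputable section

namespace STP

variable {F : Type} [Field F]

def collinearTriples (A B : Finset F) : ℕ :=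
  (((A ×ˢ A ×ˢ A) ×ˢ (B ×ˢ B ×ˢ B)).filter fun x =>
    (x.1.2.1 - x.1.1) * (x.2.2.2 - x.2.1) = (x.1.2.2 - x.1.1) * (x.2.2.1 - x.2.1)).card

def IsLine (l : Set (F × F)) : Prop :=
  ∃ a b c : F, (a, b) ≠ (0, 0) ∧ l = {p : F × F | a * p.1 + b * p.2 = c}

def incidences (P : Finset (F × F)) (L : Finset (Set (F × F))) : ℕ :=
  ((P ×ˢ L).filter fun x => x.1 ∈ x.2).card

def kIncidences (P : Finset (F × F)) (L : Finset (Set (F × F))) (k : ℕ) : ℕ :=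
  (((Fintype.piFinset fun _ : Fin k => P) ×ˢ L).filter fun x => ∀ i, x.1 i ∈ x.2).card

def numLines (P : Finset (F × F)) : ℕ :=
  Set.ncard {l : Set (F × F) | IsLine l ∧ 2 ≤ (P.filter (· ∈ l)).card}

def addEnergy (X Y : Finset F) : ℕ :=
  (((X ×ˢ X) ×ˢ (Y ×ˢ Y)).filter fun t => t.1.1 + t.2.1 = t.1.2 + t.2.2).card

def mulEnergy (A : Finset F) : ℕ :=
  (((A ×ˢ A) ×ˢ (A ×ˢ A)).filter fun t => t.1.1 * t.2.1 = t.1.2 * t.2.2).card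

def quotSet (X : Finset F) : Set F :=
  {r : F | ∃ x1 ∈ X, ∃ x2 ∈ X, ∃ x3 ∈ X, ∃ x4 ∈ X, x3 ≠ x4 ∧ r = (x1 - x2) / (x3 - x4)}

def subfieldCond (A : Finset F) (C bound : ℝ) : Prop :=
  ∀ G : Subfield F, G ≠ ⊤ → ∀ c d : F,
    ((A.filter fun x => ∃ g ∈ G, x = c * g + d).card : ℝ) ≤
      C * max ((Nat.card G : ℝ) ^ ((1:ℝ)/2)) bound

def linesOf [Fintype F] (P : Finset (F × F)) : Finset (Set (F × F)) :=
  Set.Finite.toFinset (Set.toFinite {l : Set (F × F) | IsLine l ∧ 2 ≤ (P.filter (· ∈ l)).card})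

def tripleCount [Fintype F] (P : Finset (F × F)) : ℕ :=
  ∑ l ∈ linesOf P, ((P.filter (· ∈ l)).card) ^ 3

lemma coll {α β : Type*} [DecidableEq β] (s : Finset α) (t : Finset β) (f : α → β) (hf : ∀ x ∈ s, f x ∈ t) :
    (s.card : ℝ) ^ 2 ≤ t.card * (((s ×ˢ s).filter fun p => f p.1 = f p.2).card : ℝ) := by
  have h1 : s.card = ∑ b ∈ t, (s.filter fun x => f x = b).card :=
    Finset.card_eq_sum_card_fiberwise (fun x hx => hf x hx)
  have h2 : ((s ×ˢ s).filter fun p => f p.1 = f p.2).card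
      = ∑ b ∈ t, (s.filter fun x => f x = b).card ^ 2 := by
    rw [Finset.card_eq_sum_card_fiberwise (f := fun p : α × α => f p.1) (t := t)]
    · refine Finset.sum_congr rfl fun b _ => ?_
      rw [sq, ← Finset.card_product]
      congr 1
      ext ⟨x, y⟩
      simp only [Finset.mem_filter, Finset.mem_product]
      constructor
      · rintro ⟨⟨⟨a, b⟩, c⟩, d⟩
        exact ⟨⟨a, d⟩, b, c ▸ d⟩
      · rintro ⟨⟨a, d⟩, b, e⟩
        exact ⟨⟨⟨a, b⟩, d.trans e.symm⟩, d⟩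
    · intro p hp
      have := Finset.mem_coe.1 hp
      simp only [Finset.mem_filter, Finset.mem_product] at this
      exact hf _ this.1.1
  rw [h2]
  have := sq_sum_le_card_mul_sum_sq (s := t)
    (f := fun b => ((s.filter fun x => f x = b).card : ℝ))
  rw [h1]
  push_cast
  exact this

lemma pencil {ι : Type*} (J : Finset ι) (lam mu : ι → F) (U V : Finset F) (n : ℕ)
    (hU : U.card ≤ n) (hV : V.card ≤ n)
    (two : ∀ h ∈ J, (J.filter fun h' => lam h' = lam h ∧ mu h' = mu h).card ≤ 2)
    (θ : ℝ) (rich : ∀ h ∈ J, θ ≤ ((V.filter fun v => lam h * v + mu h ∈ U).card : ℝ))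
    (p q c : F) (hpq : ¬ (p = 0 ∧ q = 0)) :
    ((J.filter fun h => lam h * p + q * mu h = c).card : ℝ) * (θ - 1) ≤ 2 * (n : ℝ) ^ 2 := by
  set P := J.filter fun h => lam h * p + q * mu h = c with hP
  set T := (P ×ˢ V).filter fun x => lam x.1 * x.2 + mu x.1 ∈ U ∧ x.2 * q ≠ p with hT
  have hup : T.card ≤ 2 * (V ×ˢ U).card := by
    refine Finset.card_le_mul_card_image_of_maps_to
      (f := fun x : ι × F => (x.2, lam x.1 * x.2 + mu x.1)) ?_ 2 ?_
    · intro x hx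
      simp only [hT, Finset.mem_filter, Finset.mem_product] at hx ⊢
      exact ⟨hx.1.2, hx.2.1⟩
    · rintro ⟨v, u⟩ -
      rcases (T.filter fun x : ι × F => (x.2, lam x.1 * x.2 + mu x.1) = (v, u)).eq_empty_or_nonempty
        with h0 | ⟨⟨h0, v0⟩, hh⟩
      · rw [h0]; simp
      · simp only [hT, hP, Finset.mem_filter, Finset.mem_product, Prod.mk.injEq] at hh
        obtain ⟨⟨⟨⟨hJ, hc⟩, hv⟩, hu, hne⟩, rfl, hu2⟩ := hh
        refine le_trans ?_ (two h0 hJ)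
        refine Finset.card_le_card_of_injOn Prod.fst ?_ ?_
        · rintro ⟨h1, v1⟩ hx
          simp only [hT, hP, Finset.coe_filter, Finset.mem_filter, Finset.mem_product,
            Prod.mk.injEq, Set.mem_ofPred_eq] at hx ⊢
          obtain ⟨⟨⟨⟨hJ1, hc1⟩, hv1⟩, hu1, hne1⟩, rfl, hu3⟩ := hx
          have e1 : (lam h1 - lam h0) * v1 + (mu h1 - mu h0) = 0 := by
            linear_combination hu3 - hu2
          have e2 : (lam h1 - lam h0) * p + q * (mu h1 - mu h0) = 0 := by
            linear_combination hc1 - hc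
          have e3 : (lam h1 - lam h0) * (v1 * q - p) = 0 := by
            linear_combination q * e1 - e2
          have e4 : lam h1 - lam h0 = 0 := by
            rcases mul_eq_zero.1 e3 with h | h
            · exact h
            · exact absurd (sub_eq_zero.1 h) hne
          refine ⟨hJ1, sub_eq_zero.1 e4, ?_⟩
          rw [e4] at e1
          simpa [sub_eq_zero] using e1
        · rintro ⟨h1, v1⟩ hx ⟨h2, v2⟩ hy hxy
          simp only [Finset.coe_filter, Finset.mem_filter, Prod.mk.injEq, Set.mem_ofPred_eq] at hx hy
          simp only at hxy
          rw [hxy, hx.2.1, hy.2.1]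
  have hlow : (P.card : ℝ) * (θ - 1) ≤ T.card := by
    have : T.card = ∑ h ∈ P, (T.filter fun x => x.1 = h).card :=
      Finset.card_eq_sum_card_fiberwise (fun x hx => by
        have := Finset.mem_coe.1 hx
        simp only [hT, Finset.mem_filter, Finset.mem_product] at this
        exact this.1.1)
    rw [this]
    push_cast
    rw [← nsmul_eq_mul]
    refine Finset.card_nsmul_le_sum _ _ _ fun h hh => ?_
    have hJ : h ∈ J := (Finset.mem_filter.1 hh).1
    have e1 := rich h hJ
    have e2 : (V.filter fun v => lam h * v + mu h ∈ U).card ≤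
        (T.filter fun x => x.1 = h).card + 1 := by
      have sub : (V.filter fun v => lam h * v + mu h ∈ U) ⊆
          ((T.filter fun x => x.1 = h).image Prod.snd) ∪ {p / q} := by
        intro v hv
        simp only [Finset.mem_filter] at hv
        simp only [Finset.mem_union, Finset.mem_image, Finset.mem_singleton]
        by_cases hvq : v * q = p
        · right
          have hq : q ≠ 0 := by
            rintro rfl
            exact hpq ⟨by simpa using hvq.symm, rfl⟩
          rw [← hvq, mul_div_assoc, div_self hq, mul_one]
        · left
          refine ⟨(h, v), ?_, rfl⟩
          simp only [hT, Finset.mem_filter, Finset.mem_product]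
          exact ⟨⟨⟨hh, hv.1⟩, hv.2, hvq⟩, trivial⟩
      calc _ ≤ _ := Finset.card_le_card sub
        _ ≤ _ := Finset.card_union_le _ _
        _ ≤ _ := by
          simp only [Finset.card_singleton]
          exact Nat.add_le_add_right Finset.card_image_le 1
    have e3 : ((V.filter fun v => lam h * v + mu h ∈ U).card : ℝ) ≤
        ((T.filter fun x => x.1 = h).card : ℝ) + 1 := by exact_mod_cast e2
    linarith
  have h3 : (V ×ˢ U).card ≤ n ^ 2 := by
    rw [Finset.card_product, sq]; exact Nat.mul_le_mul hV hU
  have h4 : (T.card : ℝ) ≤ 2 * (n : ℝ) ^ 2 := by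
    have : T.card ≤ 2 * n ^ 2 := by omega
    exact_mod_cast this
  linarith

/-- second moment of rich affine maps -/
lemma phiSum (U : Finset F) (n : ℕ) (hU : U.card ≤ n) (l1 : F) (hl1 : l1 ≠ 0)
    (Φ : Finset (F × F)) :
    (∑ φ ∈ Φ, (((U ×ˢ U).filter fun p => l1 * p.2 = φ.1 * p.1 + φ.2).card : ℝ) *
      ((((U ×ˢ U).filter fun p => l1 * p.2 = φ.1 * p.1 + φ.2).card : ℝ) - 1)) ≤ (n : ℝ) ^ 4 := by
  set E : F × F → Finset (F × F) := fun φ => (U ×ˢ U).filter fun p => l1 * p.2 = φ.1 * p.1 + φ.2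
    with hE
  have key : ∑ φ ∈ Φ, ((E φ).offDiag).card ≤ n ^ 4 := by
    rw [← Finset.card_biUnion]
    · calc _ ≤ ((U ×ˢ U) ×ˢ (U ×ˢ U)).card := by
            refine Finset.card_le_card ?_
            intro x hx
            simp only [Finset.mem_biUnion, Finset.mem_offDiag] at hx
            obtain ⟨φ, -, h1, h2, -⟩ := hx
            exact Finset.mem_product.2 ⟨(Finset.mem_filter.1 h1).1, (Finset.mem_filter.1 h2).1⟩
        _ = U.card ^ 4 := by simp only [Finset.card_product]; ring
        _ ≤ n ^ 4 := Nat.pow_le_pow_left hU 4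
    · intro φ _ ψ _ hne
      rw [Function.onFun, Finset.disjoint_left]
      rintro ⟨⟨a, b⟩, ⟨c, d⟩⟩ hx hy
      apply hne
      simp only [hE, Finset.mem_offDiag, Finset.mem_filter] at hx hy
      obtain ⟨⟨-, x1⟩, ⟨-, x2⟩, hne⟩ := hx
      obtain ⟨⟨-, y1⟩, ⟨-, y2⟩, -⟩ := hy
      have hac : a ≠ c := by
        rintro rfl
        apply hne
        have : l1 * b = l1 * d := by rw [x1, x2]
        rw [mul_left_cancel₀ hl1 this]
      have e : (φ.1 - ψ.1) * (a - c) = 0 := by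
        linear_combination x2 - x1 - y2 + y1
      have e1 : φ.1 = ψ.1 := by
        rcases mul_eq_zero.1 e with h | h
        · exact sub_eq_zero.1 h
        · exact absurd (sub_eq_zero.1 h) hac
      refine Prod.ext e1 ?_
      rw [e1] at x1
      linear_combination y1 - x1
  calc _ = ((∑ φ ∈ Φ, ((E φ).offDiag).card : ℕ) : ℝ) := by
        push_cast
        refine Finset.sum_congr rfl fun φ _ => ?_
        rw [Finset.offDiag_card, Nat.cast_sub (Nat.le_mul_self _)]
        push_cast; ring
    _ ≤ _ := by exact_mod_cast key

lemma collEq {α β : Type*} [DecidableEq β] (s : Finset α) (t : Finset β) (f : α → β) (hf : ∀ x ∈ s, f x ∈ t) :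
    ((s ×ˢ s).filter fun p => f p.1 = f p.2).card
      = ∑ b ∈ t, (s.filter fun x => f x = b).card ^ 2 := by
  rw [Finset.card_eq_sum_card_fiberwise (f := fun p : α × α => f p.1) (t := t)]
  · refine Finset.sum_congr rfl fun b _ => ?_
    rw [sq, ← Finset.card_product]
    congr 1
    ext ⟨x, y⟩
    simp only [Finset.mem_filter, Finset.mem_product]
    constructor
    · rintro ⟨⟨⟨a, b⟩, c⟩, d⟩
      exact ⟨⟨a, d⟩, b, c ▸ d⟩
    · rintro ⟨⟨a, d⟩, b, e⟩
      exact ⟨⟨⟨a, b⟩, d.trans e.symm⟩, d⟩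
  · intro p hp
    have := Finset.mem_coe.1 hp
    simp only [Finset.mem_filter, Finset.mem_product] at this
    exact hf _ this.1.1

/-- Fiber bound: a map into `t` with all fibers at most `k`. -/
lemma fiberBound {α β : Type*} [DecidableEq β] (s : Finset α) (t : Finset β) (f : α → β) (hf : ∀ x ∈ s, f x ∈ t)
    (k : ℝ) (hk : ∀ b ∈ t, ((s.filter fun x => f x = b).card : ℝ) ≤ k) :
    (s.card : ℝ) ≤ t.card * k := by
  rw [Finset.card_eq_sum_card_fiberwise (fun x hx => hf x hx)]
  push_cast
  rw [← nsmul_eq_mul]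
  exact Finset.sum_le_card_nsmul _ _ _ hk

lemma LJa {ι : Type*} (J : Finset ι) (lam mu : ι → F) (U V : Finset F) (n : ℕ)
    (hU : U.card ≤ n) (hV : V.card ≤ n) (hJ : J.card ≤ n ^ 2)
    (N : ℝ) (hN : 1 ≤ N) (hn : 1 ≤ (n : ℝ))
    (hinc : (n : ℝ) ^ 3 / N ≤ (((J ×ˢ V).filter fun x => lam x.1 * x.2 + mu x.1 ∈ U).card : ℝ)) :
    ∃ l ∈ J, (n : ℝ) ^ 5 / N ^ 4 ≤ ((((J ×ˢ J) ×ˢ (V ×ˢ V)).filter fun y =>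
      lam l * y.2.2 + mu l = lam y.1.2 * y.2.1 + mu y.1.2 ∧ lam y.1.1 * y.2.1 + mu y.1.1 ∈ U ∧
      lam y.1.1 * y.2.2 + mu y.1.1 ∈ U).card : ℝ) := by
  set s := (J ×ˢ V).filter fun x => lam x.1 * x.2 + mu x.1 ∈ U with hs
  have hn0 : (0:ℝ) < n := by linarith
  have hN0 : (0:ℝ) < N := by linarith
  have c1 := coll s V (fun x => x.2) (fun x hx => by
    simp only [hs, Finset.mem_filter, Finset.mem_product] at hx; exact hx.1.2)
  set Q := (s ×ˢ s).filter fun p => p.1.2 = p.2.2 with hQ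
  have hVr : (V.card : ℝ) ≤ n := by exact_mod_cast hV
  have hUr : (U.card : ℝ) ≤ n := by exact_mod_cast hU
  have hJr : (J.card : ℝ) ≤ (n:ℝ) ^ 2 := by exact_mod_cast hJ
  have q1 : (n:ℝ) ^ 5 / N ^ 2 ≤ Q.card := by
    have h1 : ((n:ℝ) ^ 3 / N) ^ 2 ≤ n * Q.card := by
      calc ((n:ℝ) ^ 3 / N) ^ 2 ≤ (s.card : ℝ) ^ 2 := by gcongr
        _ ≤ _ := c1
        _ ≤ _ := by gcongr
    have : ((n:ℝ) ^ 3 / N) ^ 2 = n * ((n:ℝ) ^ 5 / N ^ 2) := by field_simp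
    rw [this] at h1
    exact le_of_mul_le_mul_left h1 hn0
  have c2 := coll Q (J ×ˢ U) (fun x => (x.1.1, lam x.2.1 * x.2.2 + mu x.2.1)) (fun x hx => by
    simp only [hs, hQ, Finset.mem_filter, Finset.mem_product] at hx ⊢
    exact ⟨hx.1.1.1.1, hx.1.2.2⟩)
  set Z := (Q ×ˢ Q).filter fun p => (p.1.1.1, lam p.1.2.1 * p.1.2.2 + mu p.1.2.1) =
    (p.2.1.1, lam p.2.2.1 * p.2.2.2 + mu p.2.2.1) with hZ
  replace c2 : (Q.card : ℝ) ^ 2 ≤ (J ×ˢ U).card * (Z.card : ℝ) := by convert c2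
  have z1 : (n:ℝ) ^ 7 / N ^ 4 ≤ Z.card := by
    have h1 : ((n:ℝ) ^ 5 / N ^ 2) ^ 2 ≤ n ^ 3 * Z.card := by
      calc ((n:ℝ) ^ 5 / N ^ 2) ^ 2 ≤ (Q.card : ℝ) ^ 2 := by gcongr
        _ ≤ _ := c2
        _ ≤ (n:ℝ) ^ 3 * Z.card := by
          rw [Finset.card_product]; push_cast
          gcongr
          calc (J.card : ℝ) * U.card ≤ (n:ℝ) ^ 2 * n := by gcongr
            _ = _ := by ring
    have : ((n:ℝ) ^ 5 / N ^ 2) ^ 2 = n ^ 3 * ((n:ℝ) ^ 7 / N ^ 4) := by field_simp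
    rw [this] at h1
    exact le_of_mul_le_mul_left h1 (by positivity)
  have hJne : J.Nonempty := by
    rw [Finset.nonempty_iff_ne_empty]
    rintro rfl
    have : (0:ℝ) < (n:ℝ)^3 / N := by positivity
    simp [hs] at hinc
    linarith
  obtain ⟨l, hl, hl2⟩ := Finset.exists_le_card_fiber_of_nsmul_le_card_of_maps_to
    (s := Z) (t := J) (f := fun z => z.2.2.1) (b := (n:ℝ) ^ 5 / N ^ 4)
    (fun z hz => by
      simp only [hs, hQ, hZ, Finset.mem_filter, Finset.mem_product] at hz
      exact hz.1.2.1.2.1.1) hJne (by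
      rw [nsmul_eq_mul]
      calc (J.card : ℝ) * ((n:ℝ) ^ 5 / N ^ 4) ≤ (n:ℝ)^2 * ((n:ℝ) ^ 5 / N ^ 4) := by gcongr
        _ = (n:ℝ) ^ 7 / N ^ 4 := by ring
        _ ≤ _ := z1)
  refine ⟨l, hl, hl2.trans ?_⟩
  norm_cast
  refine Finset.card_le_card_of_injOn
    (fun z => ((z.1.1.1, z.1.2.1), (z.1.1.2, z.2.1.2))) ?_ ?_
  · rintro ⟨⟨⟨h, v⟩, ⟨l2, v2⟩⟩, ⟨⟨h', v'⟩, ⟨l', v3⟩⟩⟩ hz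
    simp only [hs, hQ, hZ, Finset.mem_filter, Finset.mem_product, Finset.coe_filter,
      Set.mem_ofPred_eq, Prod.mk.injEq] at hz ⊢
    grind
  · rintro ⟨⟨⟨h, v⟩, ⟨l2, v2⟩⟩, ⟨⟨h', v'⟩, ⟨l', v3⟩⟩⟩ hz ⟨⟨⟨g, w⟩, ⟨m2, w2⟩⟩, ⟨⟨g', w'⟩, ⟨m', w3⟩⟩⟩ hy hxy
    simp only [hs, hQ, hZ, Finset.mem_filter, Finset.mem_product, Finset.coe_filter,
      Set.mem_ofPred_eq, Prod.mk.injEq] at hz hy hxy ⊢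
    grind

lemma LJb {ι : Type*} (J : Finset ι) (lam mu : ι → F) (U V : Finset F) (n : ℕ)
    (hU : U.card ≤ n) (hV : V.card ≤ n) (hJ : J.card ≤ n ^ 2) (hlam : ∀ h ∈ J, lam h ≠ 0)
    (two : ∀ h ∈ J, (J.filter fun h' => lam h' = lam h ∧ mu h' = mu h).card ≤ 2)
    (N : ℝ) (hN : 1 ≤ N) (hn : 4 * N ^ 4 ≤ (n : ℝ))
    (rich : ∀ h ∈ J, n / N ≤ ((V.filter fun v => lam h * v + mu h ∈ U).card : ℝ))
    (l : ι) (hl : l ∈ J)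
    (hY : (n : ℝ) ^ 5 / N ^ 4 ≤ ((((J ×ˢ J) ×ˢ (V ×ˢ V)).filter fun y =>
      lam l * y.2.2 + mu l = lam y.1.2 * y.2.1 + mu y.1.2 ∧ lam y.1.1 * y.2.1 + mu y.1.1 ∈ U ∧
      lam y.1.1 * y.2.2 + mu y.1.1 ∈ U).card : ℝ)) :
    (n : ℝ) ^ 3 ≤ 64 * N ^ 9 * (((J ×ˢ J).filter fun p => lam p.1 = lam p.2).card : ℝ) := by
  set Y := ((J ×ˢ J) ×ˢ (V ×ˢ V)).filter fun y =>
      lam l * y.2.2 + mu l = lam y.1.2 * y.2.1 + mu y.1.2 ∧ lam y.1.1 * y.2.1 + mu y.1.1 ∈ U ∧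
      lam y.1.1 * y.2.2 + mu y.1.1 ∈ U with hYdef
  have hN0 : (0:ℝ) < N := by linarith
  have hN4 : (1:ℝ) ≤ N ^ 4 := one_le_pow₀ hN
  have hn1 : (4:ℝ) ≤ n := by linarith
  have hn0 : (0:ℝ) < n := by linarith
  have hVr : (V.card : ℝ) ≤ n := by exact_mod_cast hV
  have hUr : (U.card : ℝ) ≤ n := by exact_mod_cast hU
  have hJr : (J.card : ℝ) ≤ (n:ℝ) ^ 2 := by exact_mod_cast hJ
  have hl0 : lam l ≠ 0 := hlam l hl
  set B := Y.filter fun y => lam y.1.2 = lam l ∧ mu y.1.2 = mu l with hB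
  set G := Y.filter fun y => ¬ (lam y.1.2 = lam l ∧ mu y.1.2 = mu l) with hG
  have hBG : (B.card : ℝ) + G.card = Y.card := by
    exact_mod_cast Finset.card_filter_add_card_filter_not (s := Y) _
  have hBc : (B.card : ℝ) ≤ 2 * (n:ℝ) ^ 3 := by
    have h1 : B.card ≤ ((J ×ˢ (J.filter fun h' => lam h' = lam l ∧ mu h' = mu l)) ×ˢ V).card := by
      refine Finset.card_le_card_of_injOn (fun y => (y.1, y.2.1)) ?_ ?_
      · rintro ⟨⟨h, l2⟩, ⟨v, v'⟩⟩ hy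
        simp only [hB, hYdef, Finset.mem_filter, Finset.mem_product, Finset.coe_filter,
          Set.mem_ofPred_eq, Finset.mem_coe] at hy ⊢
        grind
      · rintro ⟨⟨h, l2⟩, ⟨v, v'⟩⟩ hy ⟨⟨g, m2⟩, ⟨w, w'⟩⟩ hz hyz
        simp only [hB, hYdef, Finset.mem_filter, Finset.mem_product, Finset.coe_filter,
          Set.mem_ofPred_eq, Finset.mem_coe, Prod.mk.injEq] at hy hz hyz ⊢
        obtain ⟨⟨rfl, rfl⟩, rfl⟩ := hyz
        refine ⟨⟨rfl, rfl⟩, rfl, ?_⟩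
        apply mul_left_cancel₀ hl0
        linear_combination hy.1.2.1 - hz.1.2.1
    rw [Finset.card_product, Finset.card_product] at h1
    have h2 : (B.card : ℝ) ≤ (J.card : ℝ) * ((J.filter fun h' => lam h' = lam l ∧ mu h' = mu l).card : ℝ) * V.card := by
      exact_mod_cast h1
    have h3 : ((J.filter fun h' => lam h' = lam l ∧ mu h' = mu l).card : ℝ) ≤ 2 := by
      exact_mod_cast two l hl
    calc _ ≤ _ := h2
      _ ≤ (n:ℝ)^2 * 2 * n := by gcongr
      _ = _ := by ring
  set P := (J ×ˢ J).filter fun p => ¬ (lam p.2 = lam l ∧ mu p.2 = mu l) with hP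
  set φ : ι × ι → F × F := fun p =>
    (lam p.2, lam p.1 * (mu p.2 - mu l) + (lam l - lam p.2) * mu p.1) with hφ
  set E : F × F → Finset (F × F) := fun φ => (U ×ˢ U).filter fun p => lam l * p.2 = φ.1 * p.1 + φ.2
    with hE
  have hGE : G.card ≤ ∑ p ∈ P, (E (φ p)).card := by
    rw [Finset.card_eq_sum_card_fiberwise (f := fun y => y.1) (t := P)]
    · refine Finset.sum_le_sum fun p hp => ?_
      refine Finset.card_le_card_of_injOn
        (fun y => (lam p.1 * y.2.1 + mu p.1, lam p.1 * y.2.2 + mu p.1)) ?_ ?_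
      · rintro ⟨⟨h, l2⟩, ⟨v, v'⟩⟩ hy
        simp only [hG, hYdef, hE, hφ, Finset.mem_filter, Finset.mem_product, Finset.coe_filter,
          Set.mem_ofPred_eq, Finset.mem_coe] at hy ⊢
        obtain ⟨⟨⟨⟨⟨a1, a2⟩, a3, a4⟩, a5, a6, a7⟩, a8⟩, rfl⟩ := hy
        refine ⟨⟨a6, a7⟩, ?_⟩
        simp only
        linear_combination lam h * a5
      · rintro ⟨⟨h, l2⟩, ⟨v, v'⟩⟩ hy ⟨⟨g, m2⟩, ⟨w, w'⟩⟩ hz hyz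
        simp only [hG, hYdef, Finset.mem_filter, Finset.mem_product, Finset.coe_filter,
          Set.mem_ofPred_eq, Finset.mem_coe, Prod.mk.injEq] at hy hz hyz ⊢
        obtain ⟨⟨⟨⟨⟨a1, a2⟩, a3, a4⟩, a5, a6, a7⟩, a8⟩, rfl⟩ := hy
        obtain ⟨⟨⟨⟨⟨b1, b2⟩, b3, b4⟩, b5, b6, b7⟩, b8⟩, b9⟩ := hz
        simp only [Prod.mk.injEq] at b9
        obtain ⟨rfl, rfl⟩ := b9
        have := hlam _ a1
        simp only [add_left_inj, mul_eq_mul_left_iff, this, or_false] at hyz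
        simp [hyz]
    · intro y hy
      simp only [hG, hYdef, hP, Finset.mem_filter, Finset.mem_product, Finset.coe_filter,
          Set.mem_ofPred_eq, Finset.mem_coe] at hy ⊢
      exact ⟨hy.1.1.1, hy.2⟩
  set Φ := P.image φ with hΦ
  set f : F × F → ℝ := fun x => ((P.filter fun p => φ p = x).card : ℝ) with hf
  set g : F × F → ℝ := fun x => (((E x).card - 1 : ℕ) : ℝ) with hg
  have hPc : (P.card : ℝ) ≤ (n:ℝ) ^ 4 := by
    have : P.card ≤ (J ×ˢ J).card := Finset.card_filter_le _ _
    rw [Finset.card_product] at this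
    calc (P.card : ℝ) ≤ (J.card : ℝ) * J.card := by exact_mod_cast this
      _ ≤ (n:ℝ)^2 * (n:ℝ)^2 := by gcongr
      _ = _ := by ring
  have hsum : (G.card : ℝ) ≤ (n:ℝ) ^ 4 + ∑ x ∈ Φ, f x * g x := by
    have h1 : G.card ≤ ∑ p ∈ P, (1 + ((E (φ p)).card - 1)) :=
      hGE.trans (Finset.sum_le_sum fun p _ => by omega)
    have h2 : (G.card : ℝ) ≤ ∑ p ∈ P, (1 + g (φ p)) := by
      simp only [hg]; exact_mod_cast h1
    rw [Finset.sum_add_distrib] at h2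
    have h3 : ∑ p ∈ P, g (φ p) = ∑ x ∈ Φ, f x * g x := by
      rw [Finset.sum_comp g φ]
      refine Finset.sum_congr rfl fun x _ => ?_
      rw [nsmul_eq_mul]
    rw [h3] at h2
    simp only [Finset.sum_const, nsmul_eq_mul, mul_one] at h2
    linarith
  have hg2 : ∑ x ∈ Φ, g x ^ 2 ≤ (n:ℝ) ^ 4 := by
    refine le_trans (Finset.sum_le_sum fun x _ => ?_) (phiSum U n hU (lam l) hl0 Φ)
    change (((E x).card - 1 : ℕ) : ℝ) ^ 2 ≤ ((E x).card : ℝ) * (((E x).card : ℝ) - 1)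
    rcases Nat.eq_zero_or_pos (E x).card with h | h
    · rw [h]; simp
    · rw [Nat.cast_sub h]
      have : (1:ℝ) ≤ (E x).card := by exact_mod_cast h
      push_cast
      nlinarith
  have hCS : (∑ x ∈ Φ, f x * g x) ^ 2 ≤ (∑ x ∈ Φ, f x ^ 2) * ∑ x ∈ Φ, g x ^ 2 :=
    Finset.sum_mul_sq_le_sq_mul_sq _ _ _
  set W := (P ×ˢ P).filter fun p => φ p.1 = φ p.2 with hW
  have hff : ∑ x ∈ Φ, f x ^ 2 = (W.card : ℝ) := by
    have := collEq P Φ φ (fun x hx => Finset.mem_image_of_mem _ hx)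
    have h2 : W.card = ∑ b ∈ Φ, (P.filter fun x => φ x = b).card ^ 2 := by
      rw [← this]
    rw [h2]; push_cast; rfl
  have hWlow : (n:ℝ) ^ 6 ≤ 16 * N ^ 8 * W.card := by
    rw [hff] at hCS
    have h1 : (n:ℝ) ^ 5 / (4 * N ^ 4) ≤ ∑ x ∈ Φ, f x * g x := by
      have e1 : (n:ℝ) ^ 5 / N ^ 4 = 4 * ((n:ℝ) ^ 5 / (4 * N ^ 4)) := by field_simp
      have e2 : (n:ℝ) ^ 4 ≤ (n:ℝ) ^ 5 / (4 * N ^ 4) := by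
        rw [le_div_iff₀ (by positivity)]
        calc (n:ℝ) ^ 4 * (4 * N ^ 4) ≤ (n:ℝ) ^ 4 * n := by gcongr
          _ = _ := by ring
      have e3 : 2 * (n:ℝ) ^ 3 ≤ (n:ℝ) ^ 4 := by
        have : (0:ℝ) < (n:ℝ)^3 := by positivity
        nlinarith
      rw [e1] at hY
      linarith
    have h2 : ((n:ℝ) ^ 5 / (4 * N ^ 4)) ^ 2 ≤ W.card * (n:ℝ) ^ 4 := by
      calc _ ≤ (∑ x ∈ Φ, f x * g x) ^ 2 := by gcongr
        _ ≤ _ := hCS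
        _ ≤ _ := by gcongr
    rw [div_pow, div_le_iff₀ (by positivity)] at h2
    have : (n:ℝ) ^ 4 * (n:ℝ) ^ 6 ≤ (n:ℝ)^4 * (16 * N ^ 8 * W.card) := by
      calc _ = ((n:ℝ) ^ 5) ^ 2 := by ring
        _ ≤ _ := h2
        _ = _ := by ring
    exact le_of_mul_le_mul_left this (by positivity)
  set Par := (J ×ˢ J).filter fun p => lam p.1 = lam p.2 with hPar
  have hWup : (W.card : ℝ) ≤ ((Par ×ˢ J).card : ℝ) * (4 * N * n) := by
    refine fiberBound W (Par ×ˢ J) (fun w => ((w.1.2, w.2.2), w.1.1)) ?_ _ ?_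
    · rintro ⟨⟨h, k⟩, ⟨h', k'⟩⟩ hw
      simp only [hW, hP, hPar, hφ, Finset.mem_filter, Finset.mem_product, Prod.mk.injEq] at hw ⊢
      grind
    · rintro ⟨⟨k, k'⟩, h⟩ hw
      simp only [hPar, Finset.mem_filter, Finset.mem_product] at hw
      by_cases hk' : lam k' = lam l ∧ mu k' = mu l
      · have : W.filter (fun w => ((w.1.2, w.2.2), w.1.1) = ((k, k'), h)) = ∅ := by
          apply Finset.filter_eq_empty_iff.2
          rintro ⟨⟨h, k⟩, ⟨h', k'⟩⟩ hw
          simp only [hW, hP, hφ, Finset.mem_filter, Finset.mem_product, Prod.mk.injEq] at hw ⊢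
          grind
        rw [this]; simp; positivity
      · have hp := pencil J lam mu U V n hU hV two (n / N) rich (mu k' - mu l) (lam l - lam k')
          (φ (h, k)).2 (by
            rintro ⟨x, y⟩
            exact hk' ⟨(sub_eq_zero.1 y).symm, sub_eq_zero.1 x⟩)
        have hle : ((W.filter (fun w => ((w.1.2, w.2.2), w.1.1) = ((k, k'), h))).card : ℝ) ≤
          ((J.filter fun h' => lam h' * (mu k' - mu l) + (lam l - lam k') * mu h' = (φ (h, k)).2).card : ℝ) := by
          norm_cast
          refine Finset.card_le_card_of_injOn (fun w => w.2.1) ?_ ?_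
          · rintro ⟨⟨h, k⟩, ⟨h', k'⟩⟩ hw
            simp only [hW, hP, hφ, Finset.mem_filter, Finset.mem_product, Prod.mk.injEq,
              Finset.coe_filter, Set.mem_ofPred_eq] at hw ⊢
            grind
          · rintro ⟨⟨h, k⟩, ⟨h', k'⟩⟩ hw ⟨⟨g, m⟩, ⟨g', m'⟩⟩ hz hwz
            simp only [Finset.mem_filter, Prod.mk.injEq,
              Finset.coe_filter, Set.mem_ofPred_eq] at hw hz hwz ⊢
            grind
        refine hle.trans ?_
        set X : ℝ := ((J.filter fun h' => lam h' * (mu k' - mu l) + (lam l - lam k') * mu h' = (φ (h, k)).2).card : ℝ)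
        have hX : 0 ≤ X := Nat.cast_nonneg _
        have hθ : (n:ℝ) / (2 * N) ≤ n / N - 1 := by
          have e : (n:ℝ) / N = 2 * ((n:ℝ) / (2 * N)) := by field_simp
          have : 1 ≤ (n:ℝ) / (2 * N) := by
            rw [le_div_iff₀ (by positivity)]
            have : N ≤ N ^ 4 := le_self_pow₀ hN (by norm_num)
            linarith
          linarith
        have h5 : X * ((n:ℝ) / (2 * N)) ≤ 2 * (n:ℝ) ^ 2 := le_trans (by gcongr) hp
        have h6 : X * n ≤ (4 * N * n) * n := by
          have : X * n = (X * ((n:ℝ) / (2 * N))) * (2 * N) := by field_simp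
          rw [this]
          calc _ ≤ (2 * (n:ℝ) ^ 2) * (2 * N) := by gcongr
            _ = _ := by ring
        exact le_of_mul_le_mul_right h6 hn0
  rw [Finset.card_product] at hWup
  push_cast at hWup
  have : (n:ℝ) ^ 3 * (n:ℝ) ^ 3 ≤ (n:ℝ) ^ 3 * (64 * N ^ 9 * Par.card) := by
    calc (n:ℝ) ^ 3 * (n:ℝ) ^ 3 = (n:ℝ) ^ 6 := by ring
      _ ≤ 16 * N ^ 8 * W.card := hWlow
      _ ≤ 16 * N ^ 8 * (Par.card * J.card * (4 * N * n)) := by gcongr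
      _ ≤ 16 * N ^ 8 * (Par.card * (n:ℝ)^2 * (4 * N * n)) := by gcongr
      _ = _ := by ring
  exact le_of_mul_le_mul_left this (by positivity)

lemma LL {ι : Type*} (I : Finset ι) (lam mu : ι → F) (U V : Finset F) (n : ℕ)
    (hU : U.card ≤ n) (hV : V.card ≤ n) (hI : I.card ≤ n ^ 2) (hlam : ∀ h ∈ I, lam h ≠ 0)
    (two : ∀ h ∈ I, (I.filter fun h' => lam h' = lam h ∧ mu h' = mu h).card ≤ 2)
    (M : ℝ) (hM : 1 ≤ M) (hn : 64 * M ^ 4 ≤ (n : ℝ))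
    (hinc : (n : ℝ) ^ 3 / M ≤ (((I ×ˢ V).filter fun x => lam x.1 * x.2 + mu x.1 ∈ U).card : ℝ)) :
    (n : ℝ) ^ 3 ≤ 2 ^ 15 * M ^ 9 * (((I ×ˢ I).filter fun p => lam p.1 = lam p.2).card : ℝ) := by
  have hM0 : (0:ℝ) < M := by linarith
  have hM4 : (1:ℝ) ≤ M ^ 4 := one_le_pow₀ hM
  have hn1 : (1:ℝ) ≤ n := by linarith
  set J := I.filter fun h => n / (2 * M) ≤ ((V.filter fun v => lam h * v + mu h ∈ U).card : ℝ) with hJd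
  have hJI : J ⊆ I := Finset.filter_subset _ _
  have hJ : J.card ≤ n ^ 2 := (Finset.card_le_card hJI).trans hI
  have hsplit : (((I ×ˢ V).filter fun x => lam x.1 * x.2 + mu x.1 ∈ U).card : ℝ) ≤
      (((J ×ˢ V).filter fun x => lam x.1 * x.2 + mu x.1 ∈ U).card : ℝ) +
      ((((I \ J) ×ˢ V).filter fun x => lam x.1 * x.2 + mu x.1 ∈ U).card : ℝ) := by
    norm_cast
    refine le_trans (Finset.card_le_card ?_) (Finset.card_union_le _ _)
    intro x hx
    simp only [Finset.mem_filter, Finset.mem_product, Finset.mem_union, Finset.mem_sdiff] at hx ⊢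
    tauto
  have hsmall : ((((I \ J) ×ˢ V).filter fun x => lam x.1 * x.2 + mu x.1 ∈ U).card : ℝ) ≤
      (I \ J).card * ((n:ℝ) / (2 * M)) := by
    refine fiberBound _ (I \ J) Prod.fst ?_ _ ?_
    · intro x hx
      simp only [Finset.mem_filter, Finset.mem_product] at hx
      exact hx.1.1
    · intro h hh
      have h1 : ((V.filter fun v => lam h * v + mu h ∈ U).card : ℝ) ≤ n / (2 * M) := by
        rw [Finset.mem_sdiff, hJd, Finset.mem_filter, not_and, not_le] at hh
        exact (hh.2 hh.1).le
      refine le_trans ?_ h1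
      norm_cast
      refine Finset.card_le_card_of_injOn Prod.snd ?_ ?_
      · rintro ⟨a, b⟩ hx
        simp only [Finset.mem_filter, Finset.mem_product, Finset.coe_filter, Set.mem_ofPred_eq] at hx ⊢
        grind
      · rintro ⟨a, b⟩ hx ⟨c, d⟩ hy hxy
        simp only [Finset.mem_filter, Finset.mem_product, Finset.coe_filter, Set.mem_ofPred_eq] at hx hy hxy ⊢
        grind
  have hIJ : ((I \ J).card : ℝ) ≤ (n:ℝ) ^ 2 := by
    have := (Finset.card_le_card (Finset.sdiff_subset (s := I) (t := J))).trans hI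
    exact_mod_cast this
  have hincJ : (n : ℝ) ^ 3 / (2 * M) ≤ (((J ×ˢ V).filter fun x => lam x.1 * x.2 + mu x.1 ∈ U).card : ℝ) := by
    have e1 : (n:ℝ) ^ 3 / M = 2 * ((n : ℝ) ^ 3 / (2 * M)) := by field_simp
    have e2 : ((I \ J).card : ℝ) * ((n:ℝ) / (2 * M)) ≤ (n : ℝ) ^ 3 / (2 * M) := by
      calc _ ≤ (n:ℝ) ^ 2 * ((n:ℝ) / (2 * M)) := by gcongr
        _ = _ := by ring
    rw [e1] at hinc
    linarith
  have twoJ : ∀ h ∈ J, (J.filter fun h' => lam h' = lam h ∧ mu h' = mu h).card ≤ 2 := fun h hh =>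
    (Finset.card_le_card (Finset.filter_subset_filter _ hJI)).trans (two h (hJI hh))
  obtain ⟨l, hl, hl2⟩ := LJa J lam mu U V n hU hV hJ (2 * M) (by linarith) hn1 hincJ
  have := LJb J lam mu U V n hU hV hJ (fun h hh => hlam h (hJI hh)) twoJ (2 * M) (by linarith)
    (by calc 4 * (2 * M) ^ 4 = 64 * M ^ 4 := by ring
          _ ≤ _ := hn) (fun h hh => (Finset.mem_filter.1 hh).2) l hl hl2
  calc _ ≤ _ := this
    _ = 2 ^ 15 * M ^ 9 * (((J ×ˢ J).filter fun p => lam p.1 = lam p.2).card : ℝ) := by ring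
    _ ≤ _ := by
      gcongr

lemma stepInv {v b z z0 : F} (hz : z ≠ 0) (hz0 : z0 ≠ 0) (hne : z ≠ z0)
    (h : v + z⁻¹ = b + z0⁻¹) : v ≠ b ∧ (v - b)⁻¹ = z0 ^ 2 * (z - z0)⁻¹ + z0 := by
  have hd : z - z0 ≠ 0 := sub_ne_zero.2 hne
  have e : v - b = (z - z0) / (z * z0) := by
    have : v - b = z0⁻¹ - z⁻¹ := by linear_combination h
    rw [this]; field_simp
  have hvb : v - b ≠ 0 := by rw [e]; positivity
  refine ⟨sub_ne_zero.1 hvb, ?_⟩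
  rw [e]; field_simp; ring

lemma twoToOne (A : Finset F) (h0 : (0:F) ∉ A) (hS : (0:F) ∉ A + A⁻¹) (z0 : F) (hz0 : z0 ≠ 0) :
    ∀ h ∈ A ×ˢ A, ((A ×ˢ A).filter fun h' => (h'.1 * h'.2 * z0) ^ 2 = (h.1 * h.2 * z0) ^ 2 ∧
      h'.1 ^ 2 * h'.2 ^ 2 * z0 + h'.1 ^ 2 * h'.2 + h'.1 =
      h.1 ^ 2 * h.2 ^ 2 * z0 + h.1 ^ 2 * h.2 + h.1).card ≤ 2 := by
  rintro ⟨a, b⟩ hab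
  simp only [Finset.mem_product] at hab
  have ha : a ≠ 0 := fun h => h0 (h ▸ hab.1)
  have hb : b ≠ 0 := fun h => h0 (h ▸ hab.2)
  have hk : 1 + a * b ≠ 0 := by
    intro h
    apply hS
    have : (0:F) = a + b⁻¹ := by
      field_simp; linear_combination -h
    rw [this]
    exact Finset.add_mem_add hab.1 (Finset.inv_mem_inv hab.2)
  refine le_trans (Finset.card_le_card (t := {(a, b), (a * (1 + a * b) / (1 - a * b),
    -(a * b) / (a * (1 + a * b) / (1 - a * b)))}) ?_) Finset.card_le_two
  rintro ⟨a', b'⟩ h'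
  simp only [Finset.mem_filter, Finset.mem_product, Finset.mem_insert, Finset.mem_singleton,
    Prod.mk.injEq] at h' ⊢
  obtain ⟨⟨ha'A, hb'A⟩, e1, e2⟩ := h'
  have ha' : a' ≠ 0 := fun h => h0 (h ▸ ha'A)
  have e3 : (a' * b') ^ 2 = (a * b) ^ 2 := by
    have : z0 ^ 2 * (a' * b') ^ 2 = z0 ^ 2 * (a * b) ^ 2 := by linear_combination e1
    exact mul_left_cancel₀ (pow_ne_zero 2 hz0) this
  have e4 : a' * (1 + a' * b') = a * (1 + a * b) := by
    linear_combination e2 - z0 * e3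
  rcases sq_eq_sq_iff_eq_or_eq_neg.1 e3 with h | h
  · left
    rw [h] at e4
    have : a' = a := mul_right_cancel₀ hk e4
    subst this
    exact ⟨rfl, mul_left_cancel₀ ha h⟩
  · right
    rw [h] at e4
    have hk2 : 1 - a * b ≠ 0 := by
      intro h2
      have : a * (1 + a * b) = 0 := by rw [← e4]; linear_combination a' * h2
      rcases mul_eq_zero.1 this with h | h
      · exact ha h
      · exact hk h
    have e5 : a' = a * (1 + a * b) / (1 - a * b) := by
      rw [eq_div_iff hk2]; linear_combination e4
    refine ⟨e5, ?_⟩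
    rw [← e5, eq_div_iff ha']; linear_combination h

lemma parBound [Fintype F] (A : Finset F) (z0 : F) (hz0 : z0 ≠ 0) :
    ((((A ×ˢ A) ×ˢ (A ×ˢ A)).filter fun p =>
      (p.1.1 * p.1.2 * z0) ^ 2 = (p.2.1 * p.2.2 * z0) ^ 2).card : ℝ) ≤
    2 * ((((A ×ˢ A) ×ˢ (A ×ˢ A)).filter fun p => p.1.1 * p.1.2 = p.2.1 * p.2.2).card : ℝ) := by
  set r : F → ℕ := fun t => ((A ×ˢ A).filter fun x => x.1 * x.2 = t).card with hr
  have hE : (((A ×ˢ A) ×ˢ (A ×ˢ A)).filter fun p => p.1.1 * p.1.2 = p.2.1 * p.2.2).card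
      = ∑ t : F, r t ^ 2 := by
    have := collEq (A ×ˢ A) Finset.univ (fun x : F × F => x.1 * x.2) (fun _ _ => Finset.mem_univ _)
    exact this
  have hP : (((A ×ˢ A) ×ˢ (A ×ˢ A)).filter fun p =>
      (p.1.1 * p.1.2 * z0) ^ 2 = (p.2.1 * p.2.2 * z0) ^ 2).card ≤ ∑ t : F, r t * (r t + r (-t)) := by
    rw [Finset.card_eq_sum_card_fiberwise (f := fun p => p.1.1 * p.1.2) (t := Finset.univ)
      (fun _ _ => Finset.mem_coe.2 (Finset.mem_univ _))]
    refine Finset.sum_le_sum fun t _ => ?_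
    calc _ ≤ (((A ×ˢ A).filter fun x => x.1 * x.2 = t) ×ˢ
          (((A ×ˢ A).filter fun x => x.1 * x.2 = t) ∪
          ((A ×ˢ A).filter fun x => x.1 * x.2 = -t))).card := by
          refine Finset.card_le_card ?_
          rintro ⟨⟨a, b⟩, ⟨c, d⟩⟩ h
          simp only [Finset.mem_filter, Finset.mem_product, Finset.mem_union] at h ⊢
          obtain ⟨⟨⟨hab, hcd⟩, h1⟩, h2⟩ := h
          refine ⟨⟨hab, h2⟩, ?_⟩
          have e3 : (c * d) ^ 2 = t ^ 2 := by
            have : z0 ^ 2 * (c * d) ^ 2 = z0 ^ 2 * t ^ 2 := by rw [← h2]; linear_combination -h1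
            exact mul_left_cancel₀ (pow_ne_zero 2 hz0) this
          rcases sq_eq_sq_iff_eq_or_eq_neg.1 e3 with h | h
          · left; exact ⟨hcd, h⟩
          · right; exact ⟨hcd, h⟩
      _ ≤ _ := by
          rw [Finset.card_product]
          exact Nat.mul_le_mul_left _ (Finset.card_union_le _ _)
  have hneg : ∑ t : F, r (-t) ^ 2 = ∑ t : F, r t ^ 2 :=
    Fintype.sum_equiv (Equiv.neg F) _ _ (fun _ => rfl)
  have hfin : (∑ t : F, (r t : ℝ) * (r t + r (-t))) ≤ 2 * ∑ t : F, (r t : ℝ) ^ 2 := by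
    have hneg' : ∑ t : F, (r (-t) : ℝ) ^ 2 = ∑ t : F, (r t : ℝ) ^ 2 := by exact_mod_cast hneg
    have : (∑ t : F, (r t : ℝ) * (r t + r (-t))) ≤
        ∑ t : F, (3 / 2 * (r t : ℝ) ^ 2 + 1 / 2 * (r (-t) : ℝ) ^ 2) :=
      Finset.sum_le_sum fun t _ => by nlinarith [sq_nonneg ((r t : ℝ) - r (-t))]
    rw [Finset.sum_add_distrib, ← Finset.mul_sum, ← Finset.mul_sum, hneg'] at this
    linarith
  rw [hE]
  push_cast
  refine le_trans ?_ hfin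
  exact_mod_cast hP

lemma energyBound [Fintype F] (A : Finset F) (h0 : (0:F) ∉ A) (hS : (0:F) ∉ A + A⁻¹)
    (K : ℝ) (hK : 1 ≤ K) (hcard : ((A + A⁻¹).card : ℝ) ≤ K * A.card)
    (hn : 2 ^ 10 * K ^ 12 ≤ (A.card : ℝ)) :
    (A.card : ℝ) ^ 3 ≤ 2 ^ 25 * K ^ 27 *
    ((((A ×ˢ A) ×ˢ (A ×ˢ A)).filter fun p => p.1.1 * p.1.2 = p.2.1 * p.2.2).card : ℝ) := by
  set n := A.card with hnd
  have hK0 : (0:ℝ) < K := by linarith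
  have hK12 : (1:ℝ) ≤ K ^ 12 := one_le_pow₀ hK
  have hn1 : (1:ℝ) ≤ n := by linarith
  have hn0 : (0:ℝ) < n := by linarith
  have hne : A.Nonempty := by
    rw [← Finset.card_pos]; exact_mod_cast hn0
  set S := A + A⁻¹ with hSd
  set X := (A ×ˢ A) ×ˢ (A ×ˢ A) with hX
  have hXc : (X.card : ℝ) = (n:ℝ) ^ 4 := by
    simp only [hX, Finset.card_product]; push_cast; ring
  set f : (F × F) × (F × F) → F × F × F := fun x =>
    (x.1.1 + x.1.2⁻¹, x.1.2 + x.2.1⁻¹, x.2.1 + x.2.2⁻¹) with hf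
  have hmemS : ∀ x ∈ A, ∀ y ∈ A, x + y⁻¹ ∈ S := fun x hx y hy =>
    Finset.add_mem_add hx (Finset.inv_mem_inv hy)
  have c1 := coll X (S ×ˢ S ×ˢ S) f (fun x hx => by
    simp only [hX, hf, Finset.mem_product] at hx ⊢
    exact ⟨hmemS _ hx.1.1 _ hx.1.2, hmemS _ hx.1.2 _ hx.2.1, hmemS _ hx.2.1 _ hx.2.2⟩)
  set Q := (X ×ˢ X).filter fun p => f p.1 = f p.2 with hQ
  have q1 : (n:ℝ) ^ 5 / K ^ 3 ≤ Q.card := by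
    have h1 : (n:ℝ) ^ 3 * (n:ℝ) ^ 5 ≤ (n:ℝ) ^ 3 * (Q.card * K ^ 3) := by
      calc (n:ℝ) ^ 3 * (n:ℝ) ^ 5 = (X.card : ℝ) ^ 2 := by rw [hXc]; ring
        _ ≤ _ := c1
        _ = (S.card : ℝ) ^ 3 * Q.card := by simp only [Finset.card_product]; push_cast; ring
        _ ≤ (K * n) ^ 3 * Q.card := by gcongr
        _ = _ := by ring
    rw [div_le_iff₀ (by positivity)]
    exact le_of_mul_le_mul_left h1 (by positivity)
  obtain ⟨⟨x0, z0⟩, hxz, hfib⟩ := Finset.exists_le_card_fiber_of_nsmul_le_card_of_maps_to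
    (s := Q) (t := A ×ˢ A) (f := fun p => (p.2.1.1, p.2.2.2)) (b := (n:ℝ) ^ 3 / K ^ 3)
    (fun p hp => by
      simp only [hQ, hX, Finset.mem_filter, Finset.mem_product] at hp ⊢
      exact ⟨hp.1.2.1.1, hp.1.2.2.2⟩) (hne.product hne) (by
      rw [nsmul_eq_mul, Finset.card_product]; push_cast
      calc (n:ℝ) * n * ((n:ℝ) ^ 3 / K ^ 3) = (n:ℝ) ^ 5 / K ^ 3 := by ring
        _ ≤ _ := q1)
  simp only [Finset.mem_product] at hxz
  have hA0 : ∀ x ∈ A, x ≠ 0 := fun x hx h => h0 (h ▸ hx)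
  have hz0 := hA0 _ hxz.2
  set R := Q.filter fun p => (p.2.1.1, p.2.2.2) = (x0, z0) with hR
  set D := R.filter fun p => ¬ p.1.2.2 = z0 with hD
  set D' := R.filter fun p => p.1.2.2 = z0 with hD'
  have hsum : (D'.card : ℝ) + D.card = R.card := by
    exact_mod_cast Finset.card_filter_add_card_filter_not (s := R) _
  have hD'c : (D'.card : ℝ) ≤ (n:ℝ) ^ 2 := by
    have : D'.card ≤ (A ×ˢ A).card := by
      refine Finset.card_le_card_of_injOn (fun p => (p.2.1.2, p.2.2.1)) ?_ ?_
      · rintro ⟨⟨⟨x, w⟩, ⟨v, z⟩⟩, ⟨⟨y, a⟩, ⟨b, t⟩⟩⟩ hp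
        simp only [hD', hR, hQ, hX, Finset.mem_filter, Finset.mem_product, Finset.coe_filter,
          Set.mem_ofPred_eq, Finset.mem_coe] at hp ⊢
        exact ⟨hp.1.1.1.2.1.2, hp.1.1.1.2.2.1⟩
      · rintro ⟨⟨⟨x, w⟩, ⟨v, z⟩⟩, ⟨⟨y, a⟩, ⟨b, t⟩⟩⟩ hp ⟨⟨⟨x', w'⟩, ⟨v', z'⟩⟩, ⟨⟨y', a'⟩, ⟨b', t'⟩⟩⟩ hp' he
        simp only [hD', hR, hQ, hX, hf, Finset.mem_filter, Finset.mem_product, Finset.coe_filter,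
          Set.mem_ofPred_eq, Finset.mem_coe, Prod.mk.injEq] at hp hp' he ⊢
        obtain ⟨⟨⟨-, e1, e2, e3⟩, e4, e5⟩, e6⟩ := hp
        obtain ⟨⟨⟨-, f1, f2, f3⟩, f4, f5⟩, f6⟩ := hp'
        obtain ⟨rfl, rfl⟩ := he
        subst e4 e5 e6 f4 f5 f6
        have v1 : v = b := add_right_cancel e3
        have v2 : v' = b := add_right_cancel f3
        subst v1 v2
        have v1 : w = a := add_right_cancel e2
        have v2 : w' = a := add_right_cancel f2
        subst v1 v2
        have v1 := add_right_cancel e1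
        have v2 := add_right_cancel f1
        subst v1 v2
        simp
    rw [Finset.card_product] at this
    rw [sq]; exact_mod_cast this
  have hDc : (n:ℝ) ^ 3 / (2 * K ^ 3) ≤ D.card := by
    have e1 : (n:ℝ) ^ 3 / K ^ 3 = 2 * ((n:ℝ) ^ 3 / (2 * K ^ 3)) := by field_simp
    have e2 : (n:ℝ) ^ 2 ≤ (n:ℝ) ^ 3 / (2 * K ^ 3) := by
      rw [le_div_iff₀ (by positivity)]
      have : K ^ 3 ≤ K ^ 12 := pow_le_pow_right₀ hK (by norm_num)
      calc (n:ℝ) ^ 2 * (2 * K ^ 3) ≤ (n:ℝ) ^ 2 * n := by gcongr; linarith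
        _ = _ := by ring
    rw [e1] at hfib
    linarith
  set V := (A.image fun z => (z - z0)⁻¹) with hV
  set U := (A.image fun x => (x - x0)⁻¹) with hU
  have key := LL (A ×ˢ A) (fun h => (h.1 * h.2 * z0) ^ 2)
    (fun h => h.1 ^ 2 * h.2 ^ 2 * z0 + h.1 ^ 2 * h.2 + h.1) U V n Finset.card_image_le
    Finset.card_image_le (by rw [Finset.card_product, sq])
    (fun h hh => by
      simp only [Finset.mem_product] at hh
      exact pow_ne_zero _ (mul_ne_zero (mul_ne_zero (hA0 _ hh.1) (hA0 _ hh.2)) hz0))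
    (twoToOne A h0 hS z0 hz0) (2 * K ^ 3) (by
      have := one_le_pow₀ hK (n := 3)
      linarith) (by
      calc 64 * (2 * K ^ 3) ^ 4 = 2 ^ 10 * K ^ 12 := by ring
        _ ≤ _ := hn) (by
      refine hDc.trans ?_
      norm_cast
      refine Finset.card_le_card_of_injOn
        (fun p => ((p.2.1.2, p.2.2.1), (p.1.2.2 - z0)⁻¹)) ?_ ?_
      · rintro ⟨⟨⟨x, w⟩, ⟨v, z⟩⟩, ⟨⟨y, a⟩, ⟨b, t⟩⟩⟩ hp
        simp only [hD, hR, hQ, hX, hf, Finset.mem_filter, Finset.mem_product, Finset.coe_filter,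
          Set.mem_ofPred_eq, Finset.mem_coe, Prod.mk.injEq] at hp ⊢
        obtain ⟨⟨⟨⟨⟨⟨m1, m2⟩, m3, m4⟩, ⟨m5, m6⟩, m7, m8⟩, e1, e2, e3⟩, e4, e5⟩, e6⟩ := hp
        subst e4 e5
        refine ⟨⟨⟨m6, m7⟩, Finset.mem_image_of_mem (fun z => (z - t)⁻¹) m4⟩, ?_⟩
        obtain ⟨n1, s1⟩ := stepInv (hA0 _ m4) (hA0 _ m8) e6 e3
        obtain ⟨n2, s2⟩ := stepInv (hA0 _ m3) (hA0 _ m7) n1 e2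
        obtain ⟨n3, s3⟩ := stepInv (hA0 _ m2) (hA0 _ m6) n2 e1
        have : (a * b * t) ^ 2 * (z - t)⁻¹ + (a ^ 2 * b ^ 2 * t + a ^ 2 * b + a) = (x - y)⁻¹ := by
          rw [s3, s2, s1]; ring
        rw [this]
        exact Finset.mem_image_of_mem (fun x => (x - y)⁻¹) m1
      · rintro ⟨⟨⟨x, w⟩, ⟨v, z⟩⟩, ⟨⟨y, a⟩, ⟨b, t⟩⟩⟩ hp ⟨⟨⟨x', w'⟩, ⟨v', z'⟩⟩, ⟨⟨y', a'⟩, ⟨b', t'⟩⟩⟩ hp' he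
        simp only [hD, hR, hQ, hX, hf, Finset.mem_filter, Finset.mem_product, Finset.coe_filter,
          Set.mem_ofPred_eq, Finset.mem_coe, Prod.mk.injEq] at hp hp' he ⊢
        obtain ⟨⟨⟨-, e1, e2, e3⟩, e4, e5⟩, e6⟩ := hp
        obtain ⟨⟨⟨-, f1, f2, f3⟩, f4, f5⟩, f6⟩ := hp'
        obtain ⟨⟨rfl, rfl⟩, he⟩ := he
        subst e4 e5 f4 f5
        have hz : z = z' := sub_left_injective (inv_injective he)
        subst hz
        have v1 : v = v' := add_right_cancel (e3.trans f3.symm)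
        subst v1
        have v1 : w = w' := add_right_cancel (e2.trans f2.symm)
        subst v1
        have v1 : x = x' := add_right_cancel (e1.trans f1.symm)
        subst v1
        simp)
  have pb := parBound A z0 hz0
  have h9 : (0:ℝ) ≤ 2 ^ 15 * (2 * K ^ 3) ^ 9 := by positivity
  refine key.trans ((mul_le_mul_of_nonneg_left pb h9).trans (le_of_eq ?_))
  ring

/-- `X` is covered by at most `k` translates of `j • D`. -/
def Cov (D : Finset F) (k : ℝ) (j : ℕ) (X : Finset F) : Prop :=
  ∃ C : Finset F, (C.card : ℝ) ≤ k ∧ X ⊆ C + j • D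

lemma Cov.add {D : Finset F} {k k' : ℝ} {i j : ℕ} {X Y : Finset F} (hX : Cov D k i X)
    (hY : Cov D k' j Y) : Cov D (k * k') (i + j) (X + Y) := by
  obtain ⟨C, hC, h1⟩ := hX
  obtain ⟨C', hC', h2⟩ := hY
  refine ⟨C + C', ?_, ?_⟩
  · calc ((C + C').card : ℝ) ≤ (C.card : ℝ) * C'.card := by exact_mod_cast Finset.card_add_le
      _ ≤ k * k' := by
        have : (0:ℝ) ≤ C.card := Nat.cast_nonneg _
        have : (0:ℝ) ≤ C'.card := Nat.cast_nonneg _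
        gcongr
        linarith
  · refine (Finset.add_subset_add h1 h2).trans ?_
    rw [add_nsmul, add_add_add_comm]

lemma Cov.neg {D : Finset F} (hD : -D = D) {k : ℝ} {i : ℕ} {X : Finset F} (hX : Cov D k i X) :
    Cov D k i (-X) := by
  obtain ⟨C, hC, h1⟩ := hX
  refine ⟨-C, by rwa [Finset.card_neg], ?_⟩
  have := Finset.neg_subset_neg h1
  rwa [neg_add, ← neg_nsmul, hD] at this

lemma Cov.sub {D : Finset F} (hD : -D = D) {k k' : ℝ} {i j : ℕ} {X Y : Finset F} (hX : Cov D k i X)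
    (hY : Cov D k' j Y) : Cov D (k * k') (i + j) (X - Y) := by
  rw [sub_eq_add_neg]; exact hX.add (hY.neg hD)

lemma Cov.mul {A : Finset F} {k k' : ℝ} (t t' : F) (hX : Cov (A - A) k 1 (t • A))
    (hY : Cov (A - A) k' 1 (t' • A)) (ht : t ≠ 0) : Cov (A - A) (k' * (k * k)) 2 (t • (t' • A)) := by
  have hD : -(A - A) = A - A := by rw [neg_sub]
  obtain ⟨C', hC', h2⟩ := hY
  obtain ⟨C, hC, h1⟩ := hX.sub hD hX
  rw [one_nsmul] at h2
  refine ⟨t • C' + C, ?_, ?_⟩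
  · calc ((t • C' + C).card : ℝ) ≤ ((t • C').card : ℝ) * C.card := by exact_mod_cast Finset.card_add_le
      _ ≤ k' * (k * k) := by
        rw [Finset.card_smul_finset₀ ht]
        have : (0:ℝ) ≤ C.card := Nat.cast_nonneg _
        have : (0:ℝ) ≤ C'.card := Nat.cast_nonneg _
        gcongr
        linarith
  · have h3 : t • (A - A) ⊆ t • A - t • A := by
      intro x hx
      obtain ⟨y, hy, rfl⟩ := Finset.mem_smul_finset.1 hx
      obtain ⟨a, ha, b, hb, rfl⟩ := Finset.mem_sub.1 hy
      rw [smul_sub]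
      exact Finset.sub_mem_sub (Finset.smul_mem_smul_finset ha) (Finset.smul_mem_smul_finset hb)
    calc t • (t' • A) ⊆ t • (C' + (A - A)) := Finset.smul_finset_subset_smul_finset h2
      _ = t • C' + t • (A - A) := DistribSMul.smul_add _ _ _
      _ ⊆ t • C' + (C + 2 • (A - A)) := Finset.add_subset_add_left (h3.trans h1)
      _ = _ := by rw [add_assoc]

lemma Cov.size {A : Finset F} {K k : ℝ}
    (pl : ∀ m l : ℕ, ((m • A - l • A).card : ℝ) ≤ K ^ (m + l) * A.card)
    {j : ℕ} {X : Finset F} (hX : Cov (A - A) k j X) : (X.card : ℝ) ≤ k * (K ^ (2 * j) * A.card) := by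
  obtain ⟨C, hC, h1⟩ := hX
  calc (X.card : ℝ) ≤ ((C + j • (A - A)).card : ℝ) := by exact_mod_cast Finset.card_le_card h1
    _ ≤ (C.card : ℝ) * ((j • (A - A)).card : ℝ) := by exact_mod_cast Finset.card_add_le
    _ ≤ k * (K ^ (2 * j) * A.card) := by
      have : (0:ℝ) ≤ C.card := Nat.cast_nonneg _
      have h2 := pl j j
      rw [← nsmul_sub, ← two_mul] at h2
      gcongr
      linarith

lemma covBase {A : Finset F} {K M : ℝ} (hM : 0 < M) (hA : A.Nonempty)
    (pl : ∀ m l : ℕ, ((m • A - l • A).card : ℝ) ≤ K ^ (m + l) * A.card) (t : F) (ht : t ≠ 0)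
    (hrich : (A.card : ℝ) / (2 * M) ≤ ((t • A ∩ A).card : ℝ)) :
    Cov (A - A) (2 * M * K ^ 2) 1 (t • A) := by
  have hn : (0:ℝ) < A.card := by exact_mod_cast hA.card_pos
  have hpos : (0:ℝ) < (t • A ∩ A).card := lt_of_lt_of_le (by positivity) hrich
  have hne : (t • A ∩ A).Nonempty := by
    rw [← Finset.card_pos]; exact_mod_cast hpos
  have h2 : ((A + A).card : ℝ) ≤ K ^ 2 * A.card := by
    have := pl 2 0
    rw [two_nsmul, zero_nsmul, sub_zero] at this
    simpa using this
  obtain ⟨C, -, hC, hsub⟩ := Finset.ruzsa_covering_add (A := t • A) (B := t • A ∩ A)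
    (K := 2 * M * K ^ 2) hne (by
      calc ((t • A + t • A ∩ A).card : ℝ) ≤ ((t • A + t • A).card : ℝ) := by
            exact_mod_cast Finset.card_le_card (Finset.add_subset_add_left Finset.inter_subset_left)
        _ = ((t • (A + A)).card : ℝ) := by rw [DistribSMul.smul_add]
        _ = ((A + A).card : ℝ) := by rw [Finset.card_smul_finset₀ ht]
        _ ≤ K ^ 2 * A.card := h2
        _ = (2 * M * K ^ 2) * ((A.card : ℝ) / (2 * M)) := by field_simp
        _ ≤ _ := by gcongr)
  refine ⟨C, hC, hsub.trans ?_⟩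
  rw [one_nsmul]
  exact Finset.add_subset_add_left
    (Finset.sub_subset_sub Finset.inter_subset_right Finset.inter_subset_right)

lemma pivot (A : Finset F) (h0 : (0:F) ∉ A) (hA : A.Nonempty) (M : ℝ) (hM : 0 < M)
    (hE : (A.card : ℝ) ^ 3 ≤ M *
      ((((A ×ˢ A) ×ˢ (A ×ˢ A)).filter fun p => p.1.1 * p.1.2 = p.2.1 * p.2.2).card : ℝ)) :
    ∃ b0 ∈ A, ∃ T : Finset F, (A.card : ℝ) / (2 * M) ≤ T.card ∧ ∀ t ∈ T, t ≠ 0 ∧ b0 * t ∈ A ∧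
      (A.card : ℝ) / (2 * M) ≤ ((t • A ∩ A).card : ℝ) := by
  set n := A.card with hn
  have hn0 : (0:ℝ) < n := by exact_mod_cast hA.card_pos
  have hA0 : ∀ x ∈ A, x ≠ 0 := fun x hx h => h0 (h ▸ hx)
  set Q := ((A ×ˢ A) ×ˢ (A ×ˢ A)).filter fun p => p.1.1 * p.1.2 = p.2.1 * p.2.2 with hQ
  obtain ⟨b0, hb0, hfib⟩ := Finset.exists_le_card_fiber_of_nsmul_le_card_of_maps_to
    (s := Q) (t := A) (f := fun p => p.2.1) (b := (n:ℝ) ^ 2 / M)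
    (fun p hp => by
      simp only [hQ, Finset.mem_filter, Finset.mem_product] at hp
      exact hp.1.2.1) hA (by
      rw [nsmul_eq_mul]
      have : (n:ℝ) * ((n:ℝ) ^ 2 / M) = (n:ℝ) ^ 3 / M := by ring
      rw [this, div_le_iff₀ hM, mul_comm]; exact hE)
  set R := Q.filter fun p => p.2.1 = b0 with hR
  set ρ : F → ℕ := fun a => ((A ×ˢ A).filter fun x => a * x.1 = b0 * x.2).card with hρ
  set A1 := A.filter fun a => (n:ℝ) / (2 * M) ≤ ρ a with hA1
  have hb00 := hA0 _ hb0
  have hR1 : (R.card : ℝ) ≤ ∑ a ∈ A, (ρ a : ℝ) := by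
    rw [Finset.card_eq_sum_card_fiberwise (f := fun p => p.1.1) (t := A)]
    · push_cast
      refine Finset.sum_le_sum fun a ha => ?_
      norm_cast
      refine Finset.card_le_card_of_injOn (fun p => (p.1.2, p.2.2)) ?_ ?_
      · rintro ⟨⟨x, y⟩, ⟨z, w⟩⟩ hp
        simp only [hR, hQ, Finset.mem_filter, Finset.mem_product, Finset.coe_filter,
          Set.mem_ofPred_eq, Finset.mem_coe] at hp ⊢
        grind
      · rintro ⟨⟨x, y⟩, ⟨z, w⟩⟩ hp ⟨⟨x', y'⟩, ⟨z', w'⟩⟩ hp' he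
        simp only [hR, hQ, Finset.mem_filter, Finset.mem_product, Finset.coe_filter,
          Set.mem_ofPred_eq, Finset.mem_coe, Prod.mk.injEq] at hp hp' he ⊢
        grind
    · intro p hp
      simp only [hR, hQ, Finset.mem_filter, Finset.mem_product, Finset.coe_filter,
          Set.mem_ofPred_eq, Finset.mem_coe] at hp ⊢
      exact hp.1.1.1.1
  have hρn : ∀ a ∈ A, ρ a ≤ ((b0⁻¹ * a) • A ∩ A).card := by
    intro a ha
    have ha0 := hA0 _ ha
    refine Finset.card_le_card_of_injOn (fun p => p.2) ?_ ?_
    · rintro ⟨x, y⟩ hp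
      simp only [Finset.mem_filter, Finset.mem_product, Finset.coe_filter,
          Set.mem_ofPred_eq, Finset.mem_coe, Finset.mem_inter] at hp ⊢
      refine ⟨?_, hp.1.2⟩
      have : y = (b0⁻¹ * a) • x := by
        rw [smul_eq_mul]; field_simp; rw [mul_comm]; exact hp.2.symm
      rw [this]
      exact Finset.smul_mem_smul_finset hp.1.1
    · rintro ⟨x, y⟩ hp ⟨x', y'⟩ hp' he
      simp only [Finset.mem_filter, Finset.mem_product, Finset.coe_filter,
          Set.mem_ofPred_eq, Finset.mem_coe, Prod.mk.injEq] at hp hp' he ⊢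
      subst he
      exact ⟨mul_left_cancel₀ ha0 (hp.2.trans hp'.2.symm), rfl⟩
  have hρle : ∀ a ∈ A, (ρ a : ℝ) ≤ n := by
    intro a ha
    exact_mod_cast (hρn a ha).trans (Finset.card_le_card Finset.inter_subset_right)
  have hA1c : (n:ℝ) / (2 * M) ≤ A1.card := by
    have h1 : ∑ a ∈ A, (ρ a : ℝ) ≤ A1.card * n + n * ((n:ℝ) / (2 * M)) := by
      rw [← Finset.sum_filter_add_sum_filter_not A (fun a => (n:ℝ) / (2 * M) ≤ ρ a)]
      refine add_le_add ?_ ?_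
      · rw [← nsmul_eq_mul]
        exact Finset.sum_le_card_nsmul _ _ _ fun a ha => hρle a (Finset.mem_filter.1 ha).1
      · calc _ ≤ ((A.filter fun a => ¬ (n:ℝ) / (2 * M) ≤ ρ a).card : ℝ) * ((n:ℝ) / (2 * M)) := by
              rw [← nsmul_eq_mul]
              exact Finset.sum_le_card_nsmul _ _ _ fun a ha =>
                (not_le.1 (Finset.mem_filter.1 ha).2).le
          _ ≤ _ := by
              gcongr
              exact Finset.card_filter_le _ _
    have h2 : (n:ℝ) * (2 * ((n:ℝ) / (2 * M))) ≤ n * (A1.card + (n:ℝ) / (2 * M)) := by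
      calc _ = (n:ℝ) ^ 2 / M := by field_simp
        _ ≤ _ := hfib
        _ ≤ _ := hR1
        _ ≤ _ := h1
        _ = _ := by ring
    have := le_of_mul_le_mul_left h2 hn0
    linarith
  refine ⟨b0, hb0, A1.image fun a => b0⁻¹ * a, ?_, ?_⟩
  · rwa [Finset.card_image_of_injective _ (mul_right_injective₀ (inv_ne_zero hb00))]
  · intro t ht
    obtain ⟨a, ha, rfl⟩ := Finset.mem_image.1 ht
    rw [hA1, Finset.mem_filter] at ha
    refine ⟨mul_ne_zero (inv_ne_zero hb00) (hA0 _ ha.1), ?_, ?_⟩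
    · rw [mul_inv_cancel_left₀ hb00]; exact ha.1
    · refine ha.2.trans ?_
      exact_mod_cast hρn a ha.1

/-- The quotient set of `T`. -/
def RR (T : Finset F) : Set F :=
  {r | ∃ a ∈ T, ∃ b ∈ T, ∃ c ∈ T, ∃ d ∈ T, c ≠ d ∧ r * (c - d) = a - b}

lemma memRR (T : Finset F) (s : F) (h : (T + s • T).card < T.card ^ 2) : s ∈ RR T := by
  by_contra hs
  have : (T ×ˢ T).card ≤ (T + s • T).card := by
    refine Finset.card_le_card_of_injOn (fun p => p.1 + s * p.2) ?_ ?_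
    · rintro ⟨x, y⟩ hp
      simp only [Finset.mem_coe, Finset.mem_product] at hp ⊢
      exact Finset.add_mem_add hp.1 (Finset.smul_mem_smul_finset (a := s) hp.2)
    · rintro ⟨x, y⟩ hp ⟨x', y'⟩ hp' he
      simp only [Finset.mem_coe, Finset.mem_product] at hp hp' he
      by_cases hy : y' = y
      · subst hy
        simp only [add_left_inj] at he
        rw [he]
      · exfalso
        apply hs
        exact ⟨x, hp.1, x', hp'.1, y', hp'.2, y, hp.2, hy, by linear_combination -he⟩
  rw [Finset.card_product] at this
  rw [sq] at h
  omega

lemma dilBound (A T : Finset F) (b0 : F) (hb0 : b0 ≠ 0) (hT : ∀ t ∈ T, b0 * t ∈ A) (s δ : F)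
    (hδ : δ ≠ 0) (Z : Finset F) (hZ : ∀ x ∈ A, ∀ y ∈ A, δ * x + δ * s * y ∈ Z) :
    (T + s • T).card ≤ Z.card := by
  refine Finset.card_le_card_of_injOn (fun u => δ * b0 * u) ?_ ?_
  · intro u hu
    obtain ⟨x, hx, w, hw, rfl⟩ := Finset.mem_add.1 (Finset.mem_coe.1 hu)
    obtain ⟨y, hy, rfl⟩ := Finset.mem_smul_finset.1 hw
    have := hZ _ (hT _ hx) _ (hT _ hy)
    simp only [Finset.mem_coe, smul_eq_mul]
    convert this using 1
    ring
  · exact (mul_right_injective₀ (mul_ne_zero hδ hb0)).injOn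

lemma subfieldOf [Fintype F] (R : Set F) (X : Set F) (hX : ∀ t ∈ X, t ≠ 0)
    (h0 : (0:F) ∈ R) (h1 : ∀ r ∈ R, r + 1 ∈ R) (hm : ∀ r ∈ R, ∀ t ∈ X, t * r ∈ R) :
    ∃ G : Subfield F, (∀ t ∈ X, t ∈ G) ∧ ∀ g ∈ G, g ∈ R := by
  have hinv : ∀ t ∈ X, ∀ r ∈ R, t⁻¹ * r ∈ R := by
    intro t ht r hr
    have hp : ∀ k : ℕ, t ^ k * r ∈ R := by
      intro k
      induction k with
      | zero => simpa using hr
      | succ k ih => rw [pow_succ', mul_assoc]; exact hm _ ih t ht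
    have hc : 2 ≤ Fintype.card F := Fintype.one_lt_card
    have e : t⁻¹ = t ^ (Fintype.card F - 2) := by
      have := FiniteField.pow_card_sub_one_eq_one t (hX t ht)
      have h3 : Fintype.card F - 1 = (Fintype.card F - 2) + 1 := by omega
      rw [h3, pow_succ] at this
      exact (eq_inv_of_mul_eq_one_left this).symm
    rw [e]; exact hp _
  have hmon : ∀ m ∈ Submonoid.closure X, ∀ r ∈ R, r + m ∈ R := by
    intro m hm'
    induction hm' using Submonoid.closure_induction_left with
    | one => exact h1
    | mul_left x hx y _ ih =>
      intro r hr
      have := hm _ (ih _ (hinv x hx r hr)) x hx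
      have hx0 := hX x hx
      rwa [mul_add, mul_inv_cancel_left₀ hx0] at this
  have hadd : ∀ g ∈ Subring.closure X, ∀ r ∈ R, r + g ∈ R := by
    intro g hg
    rw [Subring.mem_closure_iff] at hg
    induction hg using AddSubgroup.closure_induction with
    | mem x hx => exact hmon x hx
    | zero => intro r hr; simpa using hr
    | add x y _ _ hx hy => intro r hr; rw [← add_assoc]; exact hy _ (hx _ hr)
    | neg x _ hx =>
      intro r hr
      have hk : ∀ k : ℕ, r + k • x ∈ R := by
        intro k
        induction k with
        | zero => simpa using hr
        | succ k ih => rw [succ_nsmul, ← add_assoc]; exact hx _ ih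
      have e : -x = (Fintype.card F - 1) • x := by
        have h2 : Fintype.card F • x = 0 := card_nsmul_eq_zero
        have hc : 1 ≤ Fintype.card F := Fintype.card_pos
        have h3 : Fintype.card F = (Fintype.card F - 1) + 1 := by omega
        rw [h3, succ_nsmul] at h2
        exact (eq_neg_of_add_eq_zero_left h2).symm
      rw [e]; exact hk _
  refine ⟨{ Subring.closure X with
    inv_mem' := ?_ }, ?_, ?_⟩
  · intro x hx
    by_cases hx0 : x = 0
    · subst hx0; rw [inv_zero]; exact hx
    · have hc : 2 ≤ Fintype.card F := Fintype.one_lt_card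
      have e : x⁻¹ = x ^ (Fintype.card F - 2) := by
        have := FiniteField.pow_card_sub_one_eq_one x hx0
        have h3 : Fintype.card F - 1 = (Fintype.card F - 2) + 1 := by omega
        rw [h3, pow_succ] at this
        exact (eq_inv_of_mul_eq_one_left this).symm
      rw [e]
      exact (Subring.closure X).pow_mem hx _
  · intro t ht
    exact Subring.subset_closure ht
  · intro g hg
    have := hadd g hg 0 h0
    simpa using this

lemma cardG [Fintype F] (G : Subfield F) (T : Finset F) (B : ℝ)
    (hB : ∀ g ∈ G, ((T + g • T).card : ℝ) ≤ B) (hBT : 2 * B ≤ (T.card : ℝ) ^ 2) (hT : T.Nonempty) :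
    (Nat.card G : ℝ) ≤ 2 * B := by
  set Gs : Finset F := Finset.univ.filter fun g => g ∈ G with hGs
  have hcardG : Nat.card G = Gs.card := by
    rw [hGs, Nat.card_eq_fintype_card, Fintype.card_subtype]
  set t := T.card with ht
  have ht0 : (0:ℝ) < t := by exact_mod_cast hT.card_pos
  set E : F → Finset ((F × F) × (F × F)) := fun g =>
    ((T ×ˢ T) ×ˢ (T ×ˢ T)).filter fun p => p.1.1 + g * p.1.2 = p.2.1 + g * p.2.2 with hE
  have hB0 : 0 ≤ B := le_trans (Nat.cast_nonneg _) (hB 0 G.zero_mem)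
  have hlow : ∀ g ∈ Gs, (t:ℝ) ^ 4 ≤ B * (E g).card := by
    intro g hg
    have := coll (T ×ˢ T) (T + g • T) (fun p => p.1 + g * p.2) (fun p hp => by
      simp only [Finset.mem_product] at hp
      exact Finset.add_mem_add hp.1 (Finset.smul_mem_smul_finset (a := g) hp.2))
    calc (t:ℝ) ^ 4 = ((T ×ˢ T).card : ℝ) ^ 2 := by rw [Finset.card_product]; push_cast; ring
      _ ≤ _ := this
      _ ≤ B * (E g).card := by
        gcongr
        exact hB g (Finset.mem_filter.1 hg).2
  have hup : (∑ g ∈ Gs, ((E g).card : ℝ)) ≤ Gs.card * (t:ℝ) ^ 2 + (t:ℝ) ^ 4 := by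
    have h1 : ∀ g ∈ Gs, (E g).card = ((E g).filter fun p => p.1.2 = p.2.2).card +
        ((E g).filter fun p => ¬ p.1.2 = p.2.2).card := fun g _ =>
      (Finset.card_filter_add_card_filter_not _).symm
    have h2 : ∀ g ∈ Gs, ((E g).filter fun p => p.1.2 = p.2.2).card ≤ t ^ 2 := by
      intro g _
      have : ((E g).filter fun p => p.1.2 = p.2.2).card ≤ (T ×ˢ T).card := by
        refine Finset.card_le_card_of_injOn (fun p => p.1) ?_ ?_
        · rintro ⟨⟨x, y⟩, ⟨z, w⟩⟩ hp
          simp only [hE, Finset.mem_filter, Finset.mem_product, Finset.coe_filter,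
            Set.mem_ofPred_eq, Finset.mem_coe] at hp ⊢
          exact hp.1.1.1
        · rintro ⟨⟨x, y⟩, ⟨z, w⟩⟩ hp ⟨⟨x', y'⟩, ⟨z', w'⟩⟩ hp' he
          simp only [hE, Finset.mem_filter, Finset.mem_product, Finset.coe_filter,
            Set.mem_ofPred_eq, Finset.mem_coe, Prod.mk.injEq] at hp hp' he ⊢
          obtain ⟨rfl, rfl⟩ := he
          obtain ⟨⟨-, e1⟩, rfl⟩ := hp
          obtain ⟨⟨-, e2⟩, rfl⟩ := hp'
          exact ⟨⟨rfl, rfl⟩, add_right_cancel (e1.symm.trans e2), rfl⟩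
      rw [Finset.card_product] at this
      rw [sq]; exact this
    have h3 : ∑ g ∈ Gs, ((E g).filter fun p => ¬ p.1.2 = p.2.2).card ≤ t ^ 4 := by
      rw [← Finset.card_biUnion]
      · calc _ ≤ ((T ×ˢ T) ×ˢ (T ×ˢ T)).card := by
              refine Finset.card_le_card ?_
              intro p hp
              simp only [Finset.mem_biUnion, hE, Finset.mem_filter] at hp
              obtain ⟨g, -, h, -⟩ := hp
              exact h.1
          _ = t ^ 4 := by simp only [Finset.card_product]; ring
      · intro g _ g' _ hne
        rw [Function.onFun, Finset.disjoint_left]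
        rintro ⟨⟨x, y⟩, ⟨z, w⟩⟩ hp hp'
        simp only [hE, Finset.mem_filter] at hp hp'
        have : (g - g') * (y - w) = 0 := by linear_combination hp.1.2 - hp'.1.2
        rcases mul_eq_zero.1 this with h | h
        · exact hne (sub_eq_zero.1 h)
        · exact hp.2 (sub_eq_zero.1 h)
    have h4 : ∑ g ∈ Gs, (E g).card ≤ Gs.card * t ^ 2 + t ^ 4 := by
      rw [Finset.sum_congr rfl h1, Finset.sum_add_distrib]
      refine add_le_add ?_ h3
      exact Finset.sum_le_card_nsmul _ _ _ h2
    exact_mod_cast h4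
  have hall : (Gs.card : ℝ) * (t:ℝ) ^ 4 ≤ B * (Gs.card * (t:ℝ) ^ 2 + (t:ℝ) ^ 4) := by
    calc (Gs.card : ℝ) * (t:ℝ) ^ 4 ≤ ∑ g ∈ Gs, B * ((E g).card : ℝ) := by
          rw [← nsmul_eq_mul]; exact Finset.card_nsmul_le_sum _ _ _ hlow
      _ = B * ∑ g ∈ Gs, ((E g).card : ℝ) := by rw [Finset.mul_sum]
      _ ≤ _ := by gcongr
  rw [hcardG]
  have h5 : (Gs.card : ℝ) * (t:ℝ)^2 * (2 * B) ≤ Gs.card * (t:ℝ)^2 * (t:ℝ)^2 := by gcongr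
  have h6 : (Gs.card : ℝ) * (t:ℝ) ^ 4 ≤ (2 * B) * (t:ℝ) ^ 4 := by nlinarith
  exact le_of_mul_le_mul_right h6 (by positivity)

lemma structure1 [Fintype F] (A : Finset F) (h0 : (0:F) ∉ A) (hA : A.Nonempty) (K M : ℝ) (hK : 1 ≤ K)
    (hM : 1 ≤ M) (pl : ∀ m l : ℕ, ((m • A - l • A).card : ℝ) ≤ K ^ (m + l) * A.card)
    (hE : (A.card : ℝ) ^ 3 ≤ M *
      ((((A ×ˢ A) ×ˢ (A ×ˢ A)).filter fun p => p.1.1 * p.1.2 = p.2.1 * p.2.2).card : ℝ))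
    (hn : (2 * M * K ^ 2) ^ 12 * K ^ 16 * (8 * M ^ 2) < A.card) :
    ∃ G : Subfield F, ∃ a0 ∈ A, (A.card : ℝ) / (2 * M) ≤
      ((A.filter fun a => ∃ g ∈ G, a = a0 * g).card : ℝ) ∧
      (Nat.card G : ℝ) ≤ 2 * ((2 * M * K ^ 2) ^ 4 * K ^ 8 * A.card) := by
  have hA0 : ∀ x ∈ A, x ≠ 0 := fun x hx h => h0 (h ▸ hx)
  have hM0 : 0 < M := by linarith
  have hK0 : 0 < K := by linarith
  obtain ⟨b0, hb0, T, hTc, hT⟩ := pivot A h0 hA M hM0 hE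
  have hb00 := hA0 _ hb0
  set n := A.card with hnd
  have hn0 : (0:ℝ) < n := by exact_mod_cast hA.card_pos
  set c := 2 * M * K ^ 2 with hc
  have hc1 : 1 ≤ c := by
    have : 1 ≤ K ^ 2 := one_le_pow₀ hK
    nlinarith
  have hcov : ∀ t ∈ T, Cov (A - A) c 1 (t • A) := fun t ht =>
    covBase hM0 hA pl t (hT t ht).1 (hT t ht).2.2
  have hTA : ∀ t ∈ T, b0 * t ∈ A := fun t ht => (hT t ht).2.1
  have hD : -(A - A) = A - A := by rw [neg_sub]
  have hT2 : c ^ 12 * K ^ 16 * n * 2 < (T.card : ℝ) ^ 2 := by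
    calc c ^ 12 * K ^ 16 * n * 2 = c ^ 12 * K ^ 16 * (8 * M ^ 2) * (n / (4 * M ^ 2)) := by field_simp; ring
      _ < n * (n / (4 * M ^ 2)) := by gcongr
      _ = ((n:ℝ) / (2 * M)) ^ 2 := by ring
      _ ≤ _ := by gcongr
  have sm : ∀ (t : F), ∀ x ∈ A, t * x ∈ t • A := fun t x hx => Finset.smul_mem_smul_finset (a := t) hx
  have sm2 : ∀ (t t' : F), ∀ x ∈ A, t * t' * x ∈ t • (t' • A) := fun t t' x hx => by
    rw [mul_assoc]; exact Finset.smul_mem_smul_finset (a := t) (sm t' x hx)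
  have b1 : ∀ r ∈ RR T, ((T + r • T).card : ℝ) ≤ c ^ 4 * K ^ 8 * n := by
    rintro r ⟨t1, h1, t2, h2, t3, h3, t4, h4, hne, hr⟩
    have := dilBound A T b0 hb00 hTA r (t3 - t4) (sub_ne_zero.2 hne)
      ((t3 • A - t4 • A) + (t1 • A - t2 • A)) (by
        intro x hx y hy
        have e : (t3 - t4) * x + (t3 - t4) * r * y = (t3 * x - t4 * x) + (t1 * y - t2 * y) := by
          linear_combination y * hr
        rw [e]
        exact Finset.add_mem_add (Finset.sub_mem_sub (sm _ _ hx) (sm _ _ hx))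
          (Finset.sub_mem_sub (sm _ _ hy) (sm _ _ hy)))
    have hs := Cov.size pl (((hcov _ h3).sub hD (hcov _ h4)).add ((hcov _ h1).sub hD (hcov _ h2)))
    calc ((T + r • T).card : ℝ) ≤ _ := by exact_mod_cast this
      _ ≤ _ := hs
      _ = _ := by ring
  have b2 : ∀ r ∈ RR T, ((T + (r + 1) • T).card : ℝ) ≤ c ^ 6 * K ^ 12 * n := by
    rintro r ⟨t1, h1, t2, h2, t3, h3, t4, h4, hne, hr⟩
    have := dilBound A T b0 hb00 hTA (r + 1) (t3 - t4) (sub_ne_zero.2 hne)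
      ((t3 • A - t4 • A) + ((t1 • A - t2 • A) + (t3 • A - t4 • A))) (by
        intro x hx y hy
        have e : (t3 - t4) * x + (t3 - t4) * (r + 1) * y =
            (t3 * x - t4 * x) + ((t1 * y - t2 * y) + (t3 * y - t4 * y)) := by
          linear_combination y * hr
        rw [e]
        exact Finset.add_mem_add (Finset.sub_mem_sub (sm _ _ hx) (sm _ _ hx))
          (Finset.add_mem_add (Finset.sub_mem_sub (sm _ _ hy) (sm _ _ hy))
            (Finset.sub_mem_sub (sm _ _ hy) (sm _ _ hy))))
    have hs := Cov.size pl (((hcov _ h3).sub hD (hcov _ h4)).add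
      (((hcov _ h1).sub hD (hcov _ h2)).add ((hcov _ h3).sub hD (hcov _ h4))))
    calc ((T + (r + 1) • T).card : ℝ) ≤ _ := by exact_mod_cast this
      _ ≤ _ := hs
      _ = _ := by ring
  have b3 : ∀ r ∈ RR T, ∀ t ∈ T, ∀ t0 ∈ T, ((T + (t / t0 * r) • T).card : ℝ) ≤ c ^ 12 * K ^ 16 * n := by
    rintro r ⟨t1, h1, t2, h2, t3, h3, t4, h4, hne, hr⟩ t ht t0 ht0
    have ht00 := (hT t0 ht0).1
    have htt := (hT t ht).1
    have := dilBound A T b0 hb00 hTA (t / t0 * r) (t0 * (t3 - t4))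
      (mul_ne_zero ht00 (sub_ne_zero.2 hne))
      ((t0 • (t3 • A) - t0 • (t4 • A)) + (t • (t1 • A) - t • (t2 • A))) (by
        intro x hx y hy
        have e : t0 * (t3 - t4) * x + t0 * (t3 - t4) * (t / t0 * r) * y =
            (t0 * t3 * x - t0 * t4 * x) + (t * t1 * y - t * t2 * y) := by
          field_simp
          linear_combination t * y * hr
        rw [e]
        exact Finset.add_mem_add (Finset.sub_mem_sub (sm2 _ _ _ hx) (sm2 _ _ _ hx))
          (Finset.sub_mem_sub (sm2 _ _ _ hy) (sm2 _ _ _ hy)))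
    have m : ∀ u ∈ T, ∀ u' ∈ T, Cov (A - A) (c * (c * c)) 2 (u • (u' • A)) := fun u hu u' hu' =>
      Cov.mul u u' (hcov u hu) (hcov u' hu') (hT u hu).1
    have hs := Cov.size pl (((m _ ht0 _ h3).sub hD (m _ ht0 _ h4)).add
      ((m _ ht _ h1).sub hD (m _ ht _ h2)))
    calc ((T + (t / t0 * r) • T).card : ℝ) ≤ _ := by exact_mod_cast this
      _ ≤ _ := hs
      _ = _ := by ring
  have hbig : c ^ 12 * K ^ 16 * n < (T.card : ℝ) ^ 2 := by
    have : 0 < c ^ 12 * K ^ 16 * n := by positivity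
    linarith
  have b12 : c ^ 6 * K ^ 12 * n ≤ c ^ 12 * K ^ 16 * n := by
    gcongr <;> first | assumption | norm_num
  have b11 : c ^ 4 * K ^ 8 * n ≤ c ^ 12 * K ^ 16 * n := by
    gcongr <;> first | assumption | norm_num
  have hTne : T.Nonempty := by
    rw [← Finset.card_pos]
    have : (0:ℝ) < T.card := lt_of_lt_of_le (by positivity) hTc
    exact_mod_cast this
  obtain ⟨t0, ht0⟩ := hTne
  have ht00 := (hT t0 ht0).1
  have hzero : (0:F) ∈ RR T := by
    apply memRR
    have h1 : 1 < T.card := by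
      have h2 : (1:ℝ) < (T.card : ℝ) ^ 2 := by
        refine lt_of_le_of_lt ?_ hbig
        have : (1:ℝ) ≤ n := by exact_mod_cast hA.card_pos
        have h3 : 1 ≤ c ^ 12 := one_le_pow₀ hc1
        have h4 : 1 ≤ K ^ 16 := one_le_pow₀ hK
        have h5 : 1 ≤ c ^ 12 * K ^ 16 := one_le_mul_of_one_le_of_one_le h3 h4
        exact one_le_mul_of_one_le_of_one_le h5 this
      by_contra h
      have h3 : T.card ≤ 1 := by omega
      have : (T.card : ℝ) ≤ 1 := by exact_mod_cast h3
      have : (0:ℝ) ≤ T.card := Nat.cast_nonneg _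
      nlinarith
    have h2 : (T + (0:F) • T).card ≤ T.card := by
      calc (T + (0:F) • T).card ≤ (T + {0}).card := by
            refine Finset.card_le_card (Finset.add_subset_add_left ?_)
            intro x hx
            obtain ⟨y, hy, rfl⟩ := Finset.mem_smul_finset.1 hx
            simp
        _ = T.card := by simp
    nlinarith
  obtain ⟨G, hG1, hG2⟩ := subfieldOf (RR T) {x | ∃ t ∈ T, x = t / t0}
    (by
      rintro x ⟨t, ht, rfl⟩
      exact div_ne_zero (hT t ht).1 ht00) hzero
    (by
      intro r hr
      apply memRR
      have := (b2 r hr).trans_lt (b12.trans_lt hbig)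
      exact_mod_cast this)
    (by
      rintro r hr x ⟨t, ht, rfl⟩
      apply memRR
      have := (b3 r hr t ht t0 ht0).trans_lt hbig
      exact_mod_cast this)
  refine ⟨G, b0 * t0, hTA t0 ht0, ?_, ?_⟩
  · refine hTc.trans ?_
    norm_cast
    refine Finset.card_le_card_of_injOn (fun t => b0 * t) ?_ (mul_right_injective₀ hb00).injOn
    intro t ht
    simp only [Finset.coe_filter, Set.mem_ofPred_eq]
    refine ⟨hTA t ht, t / t0, hG1 _ ⟨t, ht, rfl⟩, ?_⟩
    field_simp
  · refine cardG G T _ (fun g hg => b1 g (hG2 g hg)) ?_ ⟨t0, ht0⟩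
    calc 2 * (c ^ 4 * K ^ 8 * n) ≤ 2 * (c ^ 12 * K ^ 16 * n) := by linarith
      _ = c ^ 12 * K ^ 16 * n * 2 := by ring
      _ ≤ _ := hT2.le

lemma cosetCount (L : AddSubgroup F) (X Y : Finset F) (hY : ∀ y ∈ Y, y ∈ L) :
    (X.image (fun x => (QuotientAddGroup.mk x : F ⧸ L))).card * Y.card ≤ (X + Y).card := by
  rw [← Finset.card_product]
  have hch : ∀ q : F ⧸ L, ∃ x : F, q ∈ X.image (fun x => (QuotientAddGroup.mk x : F ⧸ L)) →
      x ∈ X ∧ (QuotientAddGroup.mk x : F ⧸ L) = q := by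
    intro q
    by_cases hq : q ∈ X.image (fun x => (QuotientAddGroup.mk x : F ⧸ L))
    · obtain ⟨x, hx, h⟩ := Finset.mem_image.1 hq
      exact ⟨x, fun _ => ⟨hx, h⟩⟩
    · exact ⟨0, fun h => absurd h hq⟩
  choose σ hσ using hch
  refine Finset.card_le_card_of_injOn (fun p => σ p.1 + p.2) ?_ ?_
  · rintro ⟨q, y⟩ hp
    have hp := Finset.mem_product.1 (Finset.mem_coe.1 hp)
    exact Finset.add_mem_add (hσ q hp.1).1 hp.2
  · rintro ⟨q, y⟩ hp ⟨q', y'⟩ hp' he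
    have hp := Finset.mem_product.1 (Finset.mem_coe.1 hp)
    have hp' := Finset.mem_product.1 (Finset.mem_coe.1 hp')
    simp only at hp hp' he
    have h1 : q = q' := by
      rw [← (hσ q hp.1).2, ← (hσ q' hp'.1).2, QuotientAddGroup.eq]
      have e : -σ q + σ q' = y - y' := by linear_combination -he
      rw [e]
      exact L.sub_mem (hY _ hp.2) (hY _ hp'.2)
    subst h1
    rw [add_left_cancel he]

lemma boost [Fintype F] (A : Finset F) (h0 : (0:F) ∉ A) (K M : ℝ) (hK : 1 ≤ K) (hM : 1 ≤ M)
    (hcard : ((A + A⁻¹).card : ℝ) ≤ K * A.card) (G : Subfield F) (a0 : F) (ha0 : a0 ∈ A)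
    (hA' : (A.card : ℝ) / (2 * M) ≤ ((A.filter fun a => ∃ g ∈ G, a = a0 * g).card : ℝ))
    (hn : 16 * M ^ 2 * K ^ 2 < A.card) :
    (A.card : ℝ) / 2 ≤ (((A + A⁻¹)⁻¹.filter fun x => ∃ g ∈ G, x = a0 * g + 0).card : ℝ) := by
  have hA0 : ∀ x ∈ A, x ≠ 0 := fun x hx h => h0 (h ▸ hx)
  have ha00 := hA0 _ ha0
  have hM0 : 0 < M := by linarith
  have hK0 : 0 < K := by linarith
  set n := A.card with hnd
  have hn0 : (0:ℝ) < n := lt_trans (by positivity) hn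
  set S := A + A⁻¹ with hS
  set A' := A.filter fun a => ∃ g ∈ G, a = a0 * g with hA'd
  have hA'A : A' ⊆ A := Finset.filter_subset _ _
  have hmemS : ∀ x ∈ A, ∀ y ∈ A, x + y⁻¹ ∈ S := fun x hx y hy =>
    Finset.add_mem_add hx (Finset.inv_mem_inv hy)
  have hsq : a0 ^ 2 ∈ G := by
    by_contra hns
    have h1 : (A' ×ˢ A').card ≤ S.card := by
      refine Finset.card_le_card_of_injOn (fun p => p.1 + p.2⁻¹) ?_ ?_
      · rintro ⟨x, y⟩ hp
        have hp := Finset.mem_product.1 (Finset.mem_coe.1 hp)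
        exact hmemS _ (hA'A hp.1) _ (hA'A hp.2)
      · rintro ⟨x, y⟩ hp ⟨x', y'⟩ hp' he
        have hp := Finset.mem_product.1 (Finset.mem_coe.1 hp)
        have hp' := Finset.mem_product.1 (Finset.mem_coe.1 hp')
        simp only [hA'd, Finset.mem_filter] at hp hp' he
        obtain ⟨⟨-, g, hg, rfl⟩, ⟨-, k, hk, rfl⟩⟩ := hp
        obtain ⟨⟨-, g', hg', rfl⟩, ⟨-, k', hk', rfl⟩⟩ := hp'
        have e : a0 ^ 2 * (g - g') = k'⁻¹ - k⁻¹ := by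
          rw [mul_inv, mul_inv] at he
          have h2 : a0 * a0⁻¹ = 1 := mul_inv_cancel₀ ha00
          linear_combination a0 * he + (k'⁻¹ - k⁻¹) * h2
        by_cases hgg : g = g'
        · subst hgg
          have : k'⁻¹ = k⁻¹ := by
            have : k'⁻¹ - k⁻¹ = 0 := by rw [← e]; ring
            exact sub_eq_zero.1 this
          rw [inv_injective this]
        · exfalso
          apply hns
          have h3 : a0 ^ 2 = (k'⁻¹ - k⁻¹) / (g - g') := by
            rw [eq_div_iff (sub_ne_zero.2 hgg)]; exact e
          rw [h3]
          exact G.div_mem (G.sub_mem (G.inv_mem hk') (G.inv_mem hk)) (G.sub_mem hg hg')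
    rw [Finset.card_product] at h1
    have h2 : (A'.card : ℝ) * A'.card ≤ S.card := by exact_mod_cast h1
    have h3 : ((n:ℝ) / (2 * M)) * ((n:ℝ) / (2 * M)) ≤ K * n := by
      refine le_trans ?_ (h2.trans hcard)
      gcongr
    have h4 : (n:ℝ) * n ≤ (4 * M ^ 2 * K) * n := by
      have : (n:ℝ) * n = ((n:ℝ) / (2 * M)) * ((n:ℝ) / (2 * M)) * (4 * M ^ 2) := by field_simp; norm_num
      rw [this]
      calc _ ≤ K * n * (4 * M ^ 2) := by gcongr
        _ = _ := by ring
    have h5 := le_of_mul_le_mul_right h4 hn0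
    have h6 : 4 * M ^ 2 * K ≤ 16 * M ^ 2 * K ^ 2 := by
      have : K ≤ K ^ 2 := le_self_pow₀ hK (by norm_num)
      have h7 : 0 < M ^ 2 := by positivity
      nlinarith
    linarith
  let L : AddSubgroup F :=
    { carrier := {x | ∃ g ∈ G, x = a0 * g}
      zero_mem' := ⟨0, G.zero_mem, by ring⟩
      add_mem' := by
        rintro x y ⟨g, hg, rfl⟩ ⟨k, hk, rfl⟩
        exact ⟨g + k, G.add_mem hg hk, by ring⟩
      neg_mem' := by
        rintro x ⟨g, hg, rfl⟩
        exact ⟨-g, G.neg_mem hg, by ring⟩ }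
  have hLdef : ∀ x, x ∈ L ↔ ∃ g ∈ G, x = a0 * g := fun x => Iff.rfl
  have hLinv : ∀ x ∈ L, x⁻¹ ∈ L := by
    rintro x ⟨g, hg, rfl⟩
    refine ⟨(a0 ^ 2)⁻¹ * g⁻¹, G.mul_mem (G.inv_mem hsq) (G.inv_mem hg), ?_⟩
    rw [mul_inv]; field_simp
  have hLL : ∀ x ∈ L, ∀ y ∈ L, x * y ∈ G := by
    rintro x ⟨g, hg, rfl⟩ y ⟨k, hk, rfl⟩
    have : a0 * g * (a0 * k) = a0 ^ 2 * (g * k) := by ring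
    rw [this]; exact G.mul_mem hsq (G.mul_mem hg hk)
  have hGL : ∀ x ∈ L, ∀ g ∈ G, g * x ∈ L := by
    rintro x ⟨g, hg, rfl⟩ k hk
    exact ⟨k * g, G.mul_mem hk hg, by ring⟩
  have hA'L : ∀ x, x ∈ A' ↔ x ∈ A ∧ x ∈ L := fun x => by
    rw [hA'd, Finset.mem_filter, hLdef]
  have ha0L : a0 ∈ L := ⟨1, G.one_mem, by ring⟩
  have cA := cosetCount L A A'⁻¹ (by
    intro y hy
    have := ((hA'L _).1 (Finset.mem_inv'.1 hy)).2
    have := hLinv _ this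
    rwa [inv_inv] at this)
  have cI := cosetCount L A⁻¹ A' (fun y hy => ((hA'L y).1 hy).2)
  set m := (A.image (fun x => (QuotientAddGroup.mk x : F ⧸ L))).card with hm
  set m' := (A⁻¹.image (fun x => (QuotientAddGroup.mk x : F ⧸ L))).card with hm'
  have hma : ∀ k : ℕ, k * A'.card ≤ S.card → (k : ℝ) ≤ 2 * M * K := by
    intro k hk
    have h1 : (k:ℝ) * A'.card ≤ K * n := le_trans (by exact_mod_cast hk) hcard
    have h2 : (k:ℝ) * ((n:ℝ) / (2 * M)) ≤ K * n := le_trans (by gcongr) h1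
    have h3 : (k:ℝ) * n ≤ (2 * M * K) * n := by
      calc (k:ℝ) * n = (k:ℝ) * ((n:ℝ) / (2 * M)) * (2 * M) := by field_simp
        _ ≤ (K * n) * (2 * M) := by gcongr
        _ = _ := by ring
    exact le_of_mul_le_mul_right h3 hn0
  have hmb : (m:ℝ) ≤ 2 * M * K := by
    apply hma
    rw [Finset.card_inv] at cA
    exact cA.trans (Finset.card_le_card (Finset.add_subset_add_left (Finset.inv_subset_inv hA'A)))
  have hmb' : (m':ℝ) ≤ 2 * M * K := by
    apply hma
    refine cI.trans (Finset.card_le_card ?_)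
    rw [add_comm, hS]
    exact Finset.add_subset_add_right hA'A
  set B := A.filter fun x => ¬ ∃ g ∈ G, x = a0 * g with hB
  have hsplit : (A'.card : ℝ) + B.card = n := by
    exact_mod_cast Finset.card_filter_add_card_filter_not (s := A) _
  have hBc : (B.card : ℝ) ≤ m * (2 * m') := by
    refine fiberBound B (A.image (fun x => (QuotientAddGroup.mk x : F ⧸ L)))
      (fun x => (QuotientAddGroup.mk x : F ⧸ L)) ?_ _ ?_
    · intro x hx
      exact Finset.mem_image_of_mem _ (Finset.mem_filter.1 hx).1
    · intro d _
      set X := B.filter fun x => (QuotientAddGroup.mk x : F ⧸ L) = d with hX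
      have hXp : ∀ x ∈ X, x ∈ A ∧ x ∉ L := by
        intro x hx
        have := Finset.mem_filter.1 (Finset.mem_filter.1 hx).1
        exact ⟨this.1, this.2⟩
      have hXd : ∀ x ∈ X, ∀ y ∈ X, x - y ∈ L := by
        intro x hx y hy
        have h1 := (Finset.mem_filter.1 hx).2
        have h2 := (Finset.mem_filter.1 hy).2
        have := QuotientAddGroup.eq.1 (h2.trans h1.symm)
        rwa [neg_add_eq_sub] at this
      have h1 : X.card ≤ 2 * (A⁻¹.image (fun x => (QuotientAddGroup.mk x : F ⧸ L))).card := by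
        refine Finset.card_le_mul_card_image_of_maps_to
          (f := fun x => (QuotientAddGroup.mk x⁻¹ : F ⧸ L)) ?_ 2 ?_
        · intro x hx
          exact Finset.mem_image_of_mem (fun x => (QuotientAddGroup.mk x : F ⧸ L))
            (Finset.inv_mem_inv (hXp x hx).1)
        · intro e _
          by_contra hcon
          rw [not_le, Finset.two_lt_card] at hcon
          obtain ⟨x, hx, y, hy, z, hz, hxy, hxz, hyz⟩ := hcon
          obtain ⟨hxX, hxe⟩ := Finset.mem_filter.1 hx
          obtain ⟨hyX, hye⟩ := Finset.mem_filter.1 hy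
          obtain ⟨hzX, hze⟩ := Finset.mem_filter.1 hz
          have key : ∀ y ∈ X, x ≠ y → (QuotientAddGroup.mk y⁻¹ : F ⧸ L) = e → x * y ∈ G := by
            intro y hyX hxy hye
            have h2 := QuotientAddGroup.eq.1 (hye.trans hxe.symm)
            rw [neg_add_eq_sub] at h2
            have hx0 := hA0 _ (hXp x hxX).1
            have hy0 := hA0 _ (hXp y hyX).1
            have h3 : x * y = (y - x) * (x⁻¹ - y⁻¹)⁻¹ := by
              have hyx : y - x ≠ 0 := sub_ne_zero.2 hxy.symm
              have : x⁻¹ - y⁻¹ = (y - x) / (x * y) := by field_simp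
              rw [this]; field_simp
            rw [h3]
            exact hLL _ (hXd y hyX x hxX) _ (hLinv _ h2)
          have k1 := key y hyX hxy hye
          have k2 := key z hzX hxz hze
          apply (hXp x hxX).2
          have hyz0 : y - z ≠ 0 := sub_ne_zero.2 hyz
          have h5 := hGL _ (hLinv _ (hXd y hyX z hzX)) _ (G.sub_mem k1 k2)
          rwa [← mul_sub, mul_assoc, mul_inv_cancel₀ hyz0, mul_one] at h5
      exact_mod_cast h1
  have hA'half : (n:ℝ) / 2 ≤ A'.card := by
    have h1 : (m:ℝ) * (2 * m') ≤ (2 * M * K) * (2 * (2 * M * K)) :=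
      mul_le_mul hmb (by linarith) (mul_nonneg zero_le_two (Nat.cast_nonneg _))
        (mul_nonneg (mul_nonneg zero_le_two hM0.le) hK0.le)
    have h2 : (2 * M * K) * (2 * (2 * M * K)) = 8 * M ^ 2 * K ^ 2 := by ring
    rw [h2] at h1
    linarith
  refine hA'half.trans ?_
  norm_cast
  refine Finset.card_le_card_of_injOn (fun x => (x + a0⁻¹)⁻¹) ?_ ?_
  · intro x hx
    have hx := (hA'L x).1 (Finset.mem_coe.1 hx)
    simp only [Finset.coe_filter, Set.mem_ofPred_eq, add_zero]
    exact ⟨Finset.inv_mem_inv (hmemS _ hx.1 _ ha0), hLinv _ (L.add_mem hx.2 (hLinv _ ha0L))⟩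
  · intro x _ y _ he
    exact add_right_cancel (inv_injective he)

lemma plBound [Fintype F] (A : Finset F) (hA : A.Nonempty) (K : ℝ)
    (hcard : ((A + A⁻¹).card : ℝ) ≤ K * A.card) :
    ∀ m l : ℕ, ((m • A - l • A).card : ℝ) ≤ K ^ (m + l) * A.card := by
  intro m l
  have h := Finset.pluennecke_ruzsa_inequality_nsmul_sub_nsmul_add (A := A⁻¹) hA.inv A m l
  rw [Finset.card_inv, add_comm A⁻¹ A] at h
  have h2 : ((m • A - l • A).card : ℝ) ≤
      (((A + A⁻¹).card : ℝ) / A.card) ^ (m + l) * A.card := by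
    have h3 := (NNRat.cast_le (K := ℝ)).2 h
    push_cast at h3
    exact h3
  have hn : (0:ℝ) < A.card := by exact_mod_cast hA.card_pos
  refine h2.trans ?_
  gcongr
  rw [div_le_iff₀ hn]; exact hcard

lemma finalStep [Fintype F] (A : Finset F) (h0 : (0:F) ∉ A) (hS : (0:F) ∉ A + A⁻¹)
    (hA : A.Nonempty) (C K T : ℝ) (hC : 0 < C) (hK : 1 ≤ K) (hT2 : 2 ≤ T) (hTC : 2 * C ≤ T)
    (hTK : K ≤ T) (hcard : ((A + A⁻¹).card : ℝ) = K * A.card)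
    (hn : T ^ 831 < A.card) (hq : T ^ 761 * A.card < Fintype.card F)
    (hsub : subfieldCond (A + A⁻¹)⁻¹ C (((A + A⁻¹).card : ℝ) ^ ((51:ℝ)/52))) : False := by
  have hT1 : 1 ≤ T := by linarith
  have hT0 : 0 ≤ T := by linarith
  have hK0 : 0 ≤ K := by linarith
  have hn0 : (0:ℝ) < A.card := by exact_mod_cast hA.card_pos
  have mono : ∀ a b : ℕ, a + b ≤ 831 → 2 ^ a * K ^ b < (A.card : ℝ) := by
    intro a b hab
    calc 2 ^ a * K ^ b ≤ T ^ a * T ^ b := by gcongr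
      _ = T ^ (a + b) := by rw [pow_add]
      _ ≤ T ^ 831 := pow_le_pow_right₀ hT1 hab
      _ < _ := hn
  set M : ℝ := 2 ^ 25 * K ^ 27 with hMdef
  have hM : 1 ≤ M := by
    have := one_le_pow₀ hK (n := 27)
    rw [hMdef]; linarith
  have hE := energyBound A h0 hS K hK hcard.le (mono 10 12 (by norm_num)).le
  have e1 : (2 * M * K ^ 2) ^ 12 * K ^ 16 * (8 * M ^ 2) = 2 ^ 365 * K ^ 418 := by
    rw [hMdef]
    generalize K = k
    have t : (2:ℝ) ^ 365 = 2 ^ 165 * 2 ^ 200 := by rw [← pow_add]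
    rw [t]; ring
  have e2 : 16 * M ^ 2 * K ^ 2 = 2 ^ 54 * K ^ 56 := by rw [hMdef]; ring
  have e3 : 2 * ((2 * M * K ^ 2) ^ 4 * K ^ 8 * A.card) = 2 ^ 105 * K ^ 124 * (A.card : ℝ) := by
    rw [hMdef]; ring
  obtain ⟨G, a0, ha0, hA', hG⟩ := structure1 A h0 hA K M hK hM (plBound A hA K hcard.le) hE
    (by rw [e1]; exact mono _ _ (by norm_num))
  have hb := boost A h0 K M hK hM hcard.le G a0 ha0 hA'
    (by rw [e2]; exact mono _ _ (by norm_num))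
  rw [e3] at hG
  have hTn : 2 ^ 105 * K ^ 124 ≤ T ^ 229 := by
    calc 2 ^ 105 * K ^ 124 ≤ T ^ 105 * T ^ 124 := by gcongr
      _ = T ^ 229 := by rw [← pow_add]
  have hGtop : G ≠ ⊤ := by
    rintro rfl
    have h1 : Nat.card (⊤ : Subfield F) = Fintype.card F := by
      rw [← Nat.card_eq_fintype_card]
      exact Nat.card_congr (Subfield.topEquiv).toEquiv
    rw [h1] at hG
    have h2 : 2 ^ 105 * K ^ 124 * (A.card : ℝ) ≤ T ^ 761 * A.card := by
      gcongr
      exact hTn.trans (pow_le_pow_right₀ hT1 (by norm_num))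
    linarith
  have h3' := hsub G hGtop a0 0
  have h3 : (A.card : ℝ) / 2 ≤ C * max ((Nat.card G : ℝ) ^ ((1:ℝ)/2))
      (((A + A⁻¹).card : ℝ) ^ ((51:ℝ)/52)) := by
    refine le_trans (le_of_le_of_eq hb ?_) h3'
    congr!
  rcases le_total ((Nat.card G : ℝ) ^ ((1:ℝ)/2)) (((A + A⁻¹).card : ℝ) ^ ((51:ℝ)/52)) with h | h
  · rw [max_eq_right h, hcard] at h3
    have h4 : (A.card : ℝ) ≤ T * (K * A.card) ^ ((51:ℝ)/52) := by
      calc (A.card : ℝ) ≤ 2 * C * (K * A.card) ^ ((51:ℝ)/52) := by linarith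
        _ ≤ _ := by gcongr
    have h5 : (A.card : ℝ) ^ 52 ≤ T ^ 52 * (K * A.card) ^ 51 := by
      calc (A.card : ℝ) ^ 52 ≤ (T * (K * A.card) ^ ((51:ℝ)/52)) ^ 52 := by gcongr
        _ = _ := by
          rw [mul_pow, ← Real.rpow_natCast (_ ^ ((51:ℝ)/52)), ← Real.rpow_mul (by positivity)]
          norm_num
    have h6 : (A.card : ℝ) * (A.card : ℝ) ^ 51 ≤ T ^ 103 * (A.card : ℝ) ^ 51 := by
      calc (A.card : ℝ) * (A.card : ℝ) ^ 51 = (A.card : ℝ) ^ 52 := by ring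
        _ ≤ T ^ 52 * (K * A.card) ^ 51 := h5
        _ ≤ T ^ 52 * (T * A.card) ^ 51 := by gcongr
        _ = _ := by ring
    have h7 := le_of_mul_le_mul_right h6 (by positivity)
    have h8 : T ^ 103 ≤ T ^ 831 := pow_le_pow_right₀ hT1 (by norm_num)
    linarith
  · rw [max_eq_left h, ← Real.sqrt_eq_rpow] at h3
    have h4 : (A.card : ℝ) ≤ T * √(Nat.card G : ℝ) := by
      calc (A.card : ℝ) ≤ 2 * C * √(Nat.card G : ℝ) := by linarith
        _ ≤ _ := by gcongr
    have h6 : (A.card : ℝ) * A.card ≤ T ^ 231 * A.card := by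
      calc (A.card : ℝ) * A.card ≤ (T * √(Nat.card G : ℝ)) * (T * √(Nat.card G : ℝ)) := by gcongr
        _ = T ^ 2 * (√(Nat.card G : ℝ) * √(Nat.card G : ℝ)) := by ring
        _ = T ^ 2 * (Nat.card G : ℝ) := by rw [Real.mul_self_sqrt (by positivity)]
        _ ≤ T ^ 2 * (T ^ 229 * A.card) := by
          gcongr
          exact hG.trans (by gcongr)
        _ = _ := by ring
    have h7 := le_of_mul_le_mul_right h6 hn0
    have h8 : T ^ 231 ≤ T ^ 831 := pow_le_pow_right₀ hT1 (by norm_num)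
    linarith

theorem stmt10 : ∀ C : ℝ, 0 < C → ∃ c' : ℝ, 0 < c' ∧
    ∀ (F : Type) [Field F] [Fintype F] (q : ℕ), IsPrimePow q → Fintype.card F = q →
    ∀ A : Finset F, 2 ≤ A.card → (0:F) ∉ A → (0:F) ∉ A + A⁻¹ →
    subfieldCond (A + A⁻¹)⁻¹ C (((A + A⁻¹).card : ℝ) ^ ((51:ℝ)/52)) →
    c' * min ((A.card : ℝ) ^ ((1:ℝ) + 1/831))
        ((q : ℝ) ^ ((1:ℝ)/761) * (A.card : ℝ) ^ ((1:ℝ) - 1/761)) ≤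
      ((A + A⁻¹).card : ℝ) := by
  intro C hC
  have hW : 0 < 2 + 2 * C := by linarith
  refine ⟨(2 + 2 * C)⁻¹, inv_pos.2 hW, ?_⟩
  intro F _ _ q _ hq A hA2 h0 hS hsub
  by_contra hcon
  have hA : A.Nonempty := Finset.card_pos.1 (by omega)
  have hn0 : (0:ℝ) < A.card := by exact_mod_cast hA.card_pos
  have hqn : (0:ℝ) ≤ q := Nat.cast_nonneg q
  have hSn : (A.card : ℝ) ≤ (A + A⁻¹).card := by
    exact_mod_cast Finset.card_le_card_add_right hA.inv
  obtain ⟨K, hKdef⟩ : ∃ K : ℝ, K = ((A + A⁻¹).card : ℝ) / A.card := ⟨_, rfl⟩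
  have hcard : ((A + A⁻¹).card : ℝ) = K * A.card := by rw [hKdef]; field_simp
  have hK : 1 ≤ K := by rw [hKdef, le_div_iff₀ hn0]; linarith
  rw [not_le, inv_mul_eq_div, lt_div_iff₀ hW, lt_min_iff, hcard] at hcon
  obtain ⟨c1, c2⟩ := hcon
  obtain ⟨T, hT⟩ : ∃ T : ℝ, T = K * (2 + 2 * C) := ⟨_, rfl⟩
  have hT0 : 0 ≤ T := by rw [hT]; positivity
  have hTW : 2 + 2 * C ≤ T := by rw [hT]; nlinarith
  have hTK : K ≤ T := by rw [hT]; nlinarith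
  have d1 : T < (A.card : ℝ) ^ ((1:ℝ)/831) := by
    rw [Real.rpow_add hn0, Real.rpow_one] at c1
    have : (A.card : ℝ) * T < A.card * (A.card : ℝ) ^ ((1:ℝ)/831) := by
      rw [hT]; linarith
    exact lt_of_mul_lt_mul_left this hn0.le
  have d2 : T * (A.card : ℝ) ^ ((1:ℝ)/761) < (q : ℝ) ^ ((1:ℝ)/761) := by
    rw [Real.rpow_sub hn0, Real.rpow_one, mul_div_assoc', lt_div_iff₀ (Real.rpow_pos_of_pos hn0 _)] at c2
    have : (T * (A.card : ℝ) ^ ((1:ℝ)/761)) * A.card < (q : ℝ) ^ ((1:ℝ)/761) * A.card := by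
      rw [hT]; linarith
    exact lt_of_mul_lt_mul_right this hn0.le
  have pw : ∀ (x : ℝ) (k : ℕ), 0 ≤ x → k ≠ 0 → (x ^ ((1:ℝ)/k)) ^ k = x := by
    intro x k hx hk
    rw [one_div]; exact Real.rpow_inv_natCast_pow hx hk
  have p1 := pw A.card 831 hn0.le (by norm_num)
  have p2 := pw A.card 761 hn0.le (by norm_num)
  have p3 := pw q 761 hqn (by norm_num)
  push_cast at p1 p2 p3
  have e1 : T ^ 831 < (A.card : ℝ) := by
    rw [← p1]; exact pow_lt_pow_left₀ d1 hT0 (by norm_num)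
  have e2 : T ^ 761 * A.card < (Fintype.card F : ℝ) := by
    have := pow_lt_pow_left₀ d2 (mul_nonneg hT0 (Real.rpow_nonneg hn0.le _)) (show 761 ≠ 0 by norm_num)
    rwa [mul_pow, p2, p3, ← hq] at this
  exact finalStep A h0 hS hA C K T hC hK (by linarith) (by linarith) hTK hcard e1 e2 hsub

end STP
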